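/- Assume (cond1), (cond2), |U| = 1, and that Σ₀ : ℝ^d → (symmetric matrices) is Lipschitz continuous. Let v* be a bounded C^{2,α} classical solution of ρ v − F(x,Dv,D²v) = 0 on ℝ^d, v⁰ ∈ C^{2,α}(ℝ^d), and (v^n)_{n≥1} the policy iteration sequence (π^n = Γ(·, Dv^{n−1}, D²v^{n−1}), v^n solving ρ v^n − F_{π^n}(x,Dv^n,D²v^n) = 0 classically). Then there exists A₁ ≥ 1 such that if ρ ≥ A₁^{2/(1−α)}, ε₀A₁ρ^{α/2} ≤ 1 and ε₁A₁ ≤ 1, the following holds for all n ≥ 1 and x₀ ∈ ℝ^d: ρ ∫_{B₁(x₀)} |v^n − v*|² dx + ∫_{B₁(x₀)} |D(v^n − v*)|² dx ≤ C·2^{−n} + C'·ε₀²/ρ, where C > 0 depends only on d and ‖v⁰‖₂ + ‖v*‖₂, and A₁, C' > 0 depend also on λ and C₀. -/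

import Mathlib

open MeasureTheory Real Metric
noncomputable section

/-- First-order partial derivative `∂v/∂xᵢ`. -/
def pd1 (d : ℕ) (v : EuclideanSpace ℝ (Fin d) → ℝ) (x : EuclideanSpace ℝ (Fin d))
    (i : Fin d) : ℝ :=
  fderiv ℝ v x (EuclideanSpace.single i 1)

/-- Second-order partial derivative `∂²v/∂xᵢ∂xⱼ`. -/
def pd2 (d : ℕ) (v : EuclideanSpace ℝ (Fin d) → ℝ) (x : EuclideanSpace ℝ (Fin d))
    (i j : Fin d) : ℝ :=
  fderiv ℝ (fun y => fderiv ℝ v y (EuclideanSpace.single j 1)) x (EuclideanSpace.single i 1)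

/-- The exponent `(1/λ)(r(x,u) + b(x,u)·p + (1/2) tr(Σ(x,u) X))` of the Gibbs density. -/
def gibbsExponent (d l : ℕ) (lam : ℝ)
    (r : EuclideanSpace ℝ (Fin d) → EuclideanSpace ℝ (Fin l) → ℝ)
    (b : EuclideanSpace ℝ (Fin d) → EuclideanSpace ℝ (Fin l) → Fin d → ℝ)
    (S : EuclideanSpace ℝ (Fin d) → EuclideanSpace ℝ (Fin l) → Matrix (Fin d) (Fin d) ℝ)
    (x : EuclideanSpace ℝ (Fin d)) (p : Fin d → ℝ) (X : Matrix (Fin d) (Fin d) ℝ)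
    (u : EuclideanSpace ℝ (Fin l)) : ℝ :=
  (1 / lam) * (r x u + ∑ i, b x u i * p i + (1 / 2) * ∑ i, ∑ j, S x u i j * X j i)

/-- The Gibbs density `Γ(x,p,X)(u)`. -/
def gibbsDensity (d l : ℕ) (lam : ℝ) (U : Set (EuclideanSpace ℝ (Fin l)))
    (r : EuclideanSpace ℝ (Fin d) → EuclideanSpace ℝ (Fin l) → ℝ)
    (b : EuclideanSpace ℝ (Fin d) → EuclideanSpace ℝ (Fin l) → Fin d → ℝ)
    (S : EuclideanSpace ℝ (Fin d) → EuclideanSpace ℝ (Fin l) → Matrix (Fin d) (Fin d) ℝ)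
    (x : EuclideanSpace ℝ (Fin d)) (p : Fin d → ℝ) (X : Matrix (Fin d) (Fin d) ℝ)
    (u : EuclideanSpace ℝ (Fin l)) : ℝ :=
  Real.exp (gibbsExponent d l lam r b S x p X u) /
    ∫ u' in U, Real.exp (gibbsExponent d l lam r b S x p X u')

/-- The Hessian matrix of `v` at `x`. -/
def hessian (d : ℕ) (v : EuclideanSpace ℝ (Fin d) → ℝ) (x : EuclideanSpace ℝ (Fin d)) :
    Matrix (Fin d) (Fin d) ℝ :=
  Matrix.of fun i j => pd2 d v x i j

/-- The policy `π(x,·) = Γ(x, Dv(x), D²v(x))` obtained from a value function `v`. -/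
def gibbsPolicy (d l : ℕ) (lam : ℝ) (U : Set (EuclideanSpace ℝ (Fin l)))
    (r : EuclideanSpace ℝ (Fin d) → EuclideanSpace ℝ (Fin l) → ℝ)
    (b : EuclideanSpace ℝ (Fin d) → EuclideanSpace ℝ (Fin l) → Fin d → ℝ)
    (S : EuclideanSpace ℝ (Fin d) → EuclideanSpace ℝ (Fin l) → Matrix (Fin d) (Fin d) ℝ)
    (v : EuclideanSpace ℝ (Fin d) → ℝ)
    (x : EuclideanSpace ℝ (Fin d)) (u : EuclideanSpace ℝ (Fin l)) : ℝ :=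
  gibbsDensity d l lam U r b S x (fun i => pd1 d v x i) (hessian d v x) u


/-- The exploratory (entropy-regularized) Hamiltonian
`F(x,p,X) = λ ln ∫_U exp[(1/λ)(r + b·p + (1/2) tr(Σ X))] du`. -/
def expF (d l : ℕ) (lam : ℝ) (U : Set (EuclideanSpace ℝ (Fin l)))
    (r : EuclideanSpace ℝ (Fin d) → EuclideanSpace ℝ (Fin l) → ℝ)
    (b : EuclideanSpace ℝ (Fin d) → EuclideanSpace ℝ (Fin l) → Fin d → ℝ)
    (S : EuclideanSpace ℝ (Fin d) → EuclideanSpace ℝ (Fin l) → Matrix (Fin d) (Fin d) ℝ)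
    (x : EuclideanSpace ℝ (Fin d)) (p : Fin d → ℝ) (X : Matrix (Fin d) (Fin d) ℝ) : ℝ :=
  lam * Real.log (∫ u in U, Real.exp (gibbsExponent d l lam r b S x p X u))

section Calculus

variable {d : ℕ}

local notation "𝔼" => EuclideanSpace ℝ (Fin d)

lemma pd1_contDiff {w : 𝔼 → ℝ} {n m : ℕ∞} (hw : ContDiff ℝ n w) (hmn : m + 1 ≤ n) (i : Fin d) :
    ContDiff ℝ m fun x => pd1 d w x i :=
  (hw.fderiv_right (m := m) (by exact_mod_cast hmn)).clm_apply contDiff_const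

lemma pd1_continuous {w : 𝔼 → ℝ} (hw : ContDiff ℝ 1 w) (i : Fin d) :
    Continuous fun x => pd1 d w x i :=
  (hw.continuous_fderiv (by norm_num)).clm_apply continuous_const

lemma pd1_contDiff_one {w : 𝔼 → ℝ} (hw : ContDiff ℝ 2 w) (i : Fin d) :
    ContDiff ℝ 1 fun x => pd1 d w x i :=
  pd1_contDiff (n := 2) (m := 1) hw (by norm_num) i

lemma pd2_eq_pd1 (w : 𝔼 → ℝ) (x : 𝔼) (i j : Fin d) :
    pd2 d w x i j = pd1 d (fun y => pd1 d w y j) x i := rfl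

lemma pd2_continuous {w : 𝔼 → ℝ} (hw : ContDiff ℝ 2 w) (i j : Fin d) :
    Continuous fun x => pd2 d w x i j :=
  pd1_continuous (pd1_contDiff_one hw j) i

lemma pd1_hasCompactSupport {w : 𝔼 → ℝ} (hw : HasCompactSupport w) (i : Fin d) :
    HasCompactSupport fun x => pd1 d w x i :=
  hw.fderiv_apply ℝ _

lemma pd2_hasCompactSupport {w : 𝔼 → ℝ} (hw : HasCompactSupport w) (i j : Fin d) :
    HasCompactSupport fun x => pd2 d w x i j :=
  pd1_hasCompactSupport (pd1_hasCompactSupport hw j) i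

lemma pd1_mul {f g : 𝔼 → ℝ} {x : 𝔼} (hf : DifferentiableAt ℝ f x) (hg : DifferentiableAt ℝ g x)
    (i : Fin d) :
    pd1 d (fun y => f y * g y) x i = f x * pd1 d g x i + g x * pd1 d f x i := by
  simp [pd1, fderiv_fun_mul hf hg]

lemma pd1_add {f g : 𝔼 → ℝ} {x : 𝔼} (hf : DifferentiableAt ℝ f x) (hg : DifferentiableAt ℝ g x)
    (i : Fin d) :
    pd1 d (fun y => f y + g y) x i = pd1 d f x i + pd1 d g x i := by
  simp [pd1, fderiv_fun_add hf hg]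

lemma pd1_sub {f g : 𝔼 → ℝ} {x : 𝔼} (hf : DifferentiableAt ℝ f x) (hg : DifferentiableAt ℝ g x)
    (i : Fin d) :
    pd1 d (fun y => f y - g y) x i = pd1 d f x i - pd1 d g x i := by
  simp [pd1, fderiv_fun_sub hf hg]

lemma pd2_sub {f g : 𝔼 → ℝ} (hf : ContDiff ℝ 2 f) (hg : ContDiff ℝ 2 g) (x : 𝔼) (i j : Fin d) :
    pd2 d (fun y => f y - g y) x i j = pd2 d f x i j - pd2 d g x i j := by
  have h : (fun y => pd1 d (fun y => f y - g y) y j) = fun y => pd1 d f y j - pd1 d g y j := by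
    ext y
    exact pd1_sub (hf.differentiable (by norm_num) y) (hg.differentiable (by norm_num) y) j
  rw [pd2_eq_pd1, h, pd1_sub ((pd1_contDiff_one hf j).differentiable (by norm_num) x)
    ((pd1_contDiff_one hg j).differentiable (by norm_num) x)]
  rfl

lemma pd2_mul {f g : 𝔼 → ℝ} (hf : ContDiff ℝ 2 f) (hg : ContDiff ℝ 2 g) (x : 𝔼) (i j : Fin d) :
    pd2 d (fun y => f y * g y) x i j =
      f x * pd2 d g x i j + pd1 d f x i * pd1 d g x j + pd1 d f x j * pd1 d g x i
        + g x * pd2 d f x i j := by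
  have h : (fun y => pd1 d (fun y => f y * g y) y j) =
      fun y => f y * pd1 d g y j + g y * pd1 d f y j := by
    ext y
    exact pd1_mul (hf.differentiable (by norm_num) y) (hg.differentiable (by norm_num) y) j
  have hf0 := hf.differentiable (by norm_num) x
  have hg0 := hg.differentiable (by norm_num) x
  have hf1 := (pd1_contDiff_one hf j).differentiable (by norm_num) x
  have hg1 := (pd1_contDiff_one hg j).differentiable (by norm_num) x
  rw [pd2_eq_pd1, h, pd1_add (hf0.fun_mul hg1) (hg0.fun_mul hf1), pd1_mul hf0 hg1, pd1_mul hg0 hf1]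
  simp only [pd2_eq_pd1]
  ring

lemma pd2_eq_fderiv_fderiv {w : 𝔼 → ℝ} (hw : ContDiff ℝ 2 w) (x : 𝔼) (i j : Fin d) :
    pd2 d w x i j =
      fderiv ℝ (fderiv ℝ w) x (EuclideanSpace.single i 1) (EuclideanSpace.single j 1) := by
  have h : DifferentiableAt ℝ (fderiv ℝ w) x :=
    (hw.fderiv_right (m := 1) (by norm_num)).differentiable (by norm_num) x
  rw [pd2, fderiv_clm_apply h (differentiableAt_const _)]
  simp

lemma pd2_symm {w : 𝔼 → ℝ} (hw : ContDiff ℝ 2 w) (x : 𝔼) (i j : Fin d) :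
    pd2 d w x i j = pd2 d w x j i := by
  rw [pd2_eq_fderiv_fderiv hw, pd2_eq_fderiv_fderiv hw]
  exact (hw.contDiffAt.isSymmSndFDerivAt (by simp)) _ _

lemma abs_pd1_le (w : 𝔼 → ℝ) (x : 𝔼) (i : Fin d) : |pd1 d w x i| ≤ ‖fderiv ℝ w x‖ := by
  simpa [pd1] using (fderiv ℝ w x).le_opNorm (EuclideanSpace.single i 1)

lemma abs_pd2_le {w : 𝔼 → ℝ} (hw : ContDiff ℝ 2 w) (x : 𝔼) (i j : Fin d) :
    |pd2 d w x i j| ≤ ‖iteratedFDeriv ℝ 2 w x‖ := by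
  rw [pd2_eq_fderiv_fderiv hw]
  have h := (iteratedFDeriv ℝ 2 w x).le_opNorm
    ![EuclideanSpace.single i (1 : ℝ), EuclideanSpace.single j 1]
  rw [iteratedFDeriv_two_apply] at h
  simpa [Fin.prod_univ_two] using h

lemma norm_sq_fderiv_le (w : 𝔼 → ℝ) (x : 𝔼) : ‖fderiv ℝ w x‖ ^ 2 ≤ ∑ i, pd1 d w x i ^ 2 := by
  have h0 : 0 ≤ ∑ i, pd1 d w x i ^ 2 := Finset.sum_nonneg fun i _ => sq_nonneg _
  have h : ‖fderiv ℝ w x‖ ≤ √(∑ i, pd1 d w x i ^ 2) := by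
    refine ContinuousLinearMap.opNorm_le_bound _ (Real.sqrt_nonneg _) fun y => ?_
    have hy : fderiv ℝ w x y = ∑ i, pd1 d w x i * y i := by
      conv_lhs => rw [← (EuclideanSpace.basisFun (Fin d) ℝ).sum_repr y]
      simp [pd1, mul_comm]
    rw [hy, Real.norm_eq_abs, EuclideanSpace.norm_eq, ← Real.sqrt_mul h0]
    refine Real.abs_le_sqrt ?_
    simpa using Finset.sum_mul_sq_le_sq_mul_sq Finset.univ (fun i => pd1 d w x i) fun i => y i
  calc ‖fderiv ℝ w x‖ ^ 2 ≤ √(∑ i, pd1 d w x i ^ 2) ^ 2 := by gcongr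
    _ = _ := Real.sq_sqrt h0

lemma integral_mul_pd1_eq_neg {f g : 𝔼 → ℝ} (hf : ContDiff ℝ 1 f) (hg : ContDiff ℝ 1 g)
    (hc : HasCompactSupport f) (i : Fin d) :
    ∫ x, f x * pd1 d g x i = -∫ x, pd1 d f x i * g x := by
  refine integral_mul_fderiv_eq_neg_fderiv_mul_of_integrable (v := EuclideanSpace.single i (1 : ℝ))
    ?_ ?_ ?_ (fun x _ => hf.differentiable (by norm_num) x)
    (fun x _ => hg.differentiable (by norm_num) x)
  · exact ((pd1_continuous hf i).mul hg.continuous).integrable_of_hasCompactSupport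
      (pd1_hasCompactSupport hc i).mul_right
  · exact (hf.continuous.mul (pd1_continuous hg i)).integrable_of_hasCompactSupport hc.mul_right
  · exact (hf.continuous.mul hg.continuous).integrable_of_hasCompactSupport hc.mul_right

open scoped Convolution in
lemma pd1_convolution_right {f g : 𝔼 → ℝ} (hf : Continuous f) (hg : ContDiff ℝ 1 g)
    (hcg : HasCompactSupport g) (x : 𝔼) (i : Fin d) :
    pd1 d (f ⋆[ContinuousLinearMap.mul ℝ ℝ, volume] g) x i =
      (f ⋆[ContinuousLinearMap.mul ℝ ℝ, volume] fun y => pd1 d g y i) x := by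
  rw [pd1, (hcg.hasFDerivAt_convolution_right _ hf.locallyIntegrable hg x).fderiv]
  exact convolution_precompR_apply _ hf.locallyIntegrable (hcg.fderiv ℝ)
    (hg.continuous_fderiv (by norm_num)) x _

open scoped Convolution in
lemma pd1_convolution_left {f g : 𝔼 → ℝ} (hf : ContDiff ℝ 1 f) (hg : Continuous g)
    (hcf : HasCompactSupport f) (x : 𝔼) (i : Fin d) :
    pd1 d (f ⋆[ContinuousLinearMap.mul ℝ ℝ, volume] g) x i =
      ((fun y => pd1 d f y i) ⋆[ContinuousLinearMap.mul ℝ ℝ, volume] g) x := by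
  have h : (ContinuousLinearMap.mul ℝ ℝ).flip = ContinuousLinearMap.mul ℝ ℝ := by
    ext; simp
  have hflip : ∀ k : 𝔼 → ℝ, (k ⋆[ContinuousLinearMap.mul ℝ ℝ, volume] g) =
      g ⋆[ContinuousLinearMap.mul ℝ ℝ, volume] k := fun k => by
    rw [← convolution_flip, h]
  rw [hflip, hflip]
  exact pd1_convolution_right hg hf hcf x i

open scoped Convolution in
lemma integral_pd1_mul_pd1_comm {f g : 𝔼 → ℝ} (hf : ContDiff ℝ 1 f) (hg : ContDiff ℝ 1 g)
    (hcf : HasCompactSupport f) (hcg : HasCompactSupport g) (i j : Fin d) :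
    ∫ x, pd1 d f x i * pd1 d g x j = ∫ x, pd1 d f x j * pd1 d g x i := by
  set F : 𝔼 → ℝ := fun x => f (-x) with hF
  have hFc : ContDiff ℝ 1 F := hf.comp contDiff_neg
  have hFs : HasCompactSupport F := hcf.comp_homeomorph (Homeomorph.neg 𝔼)
  have hFd : ∀ x k, pd1 d F x k = -pd1 d f (-x) k := by
    intro x k
    have h1 : HasFDerivAt f (fderiv ℝ f (-x)) (-x) :=
      (hf.differentiable (by norm_num) (-x)).hasFDerivAt
    have h2 : HasFDerivAt F _ x := h1.comp x (hasFDerivAt_id x).neg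
    simp [pd1, h2.fderiv]
  have key : ∀ a b, pd1 d (fun y => pd1 d (F ⋆[ContinuousLinearMap.mul ℝ ℝ, volume] g) y a) 0 b
      = -∫ x, pd1 d f x a * pd1 d g x b := by
    intro a b
    have h1 : (fun y => pd1 d (F ⋆[ContinuousLinearMap.mul ℝ ℝ, volume] g) y a) =
        (fun y => pd1 d F y a) ⋆[ContinuousLinearMap.mul ℝ ℝ, volume] g := by
      ext y; exact pd1_convolution_left hFc hg.continuous hFs y a
    rw [h1, pd1_convolution_right (pd1_continuous hFc a) hg hcg, convolution_def,
      ← integral_neg_eq_self]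
    simp [hFd, integral_neg]
  have key' : ∀ a b, pd1 d (fun y => pd1 d (F ⋆[ContinuousLinearMap.mul ℝ ℝ, volume] g) y a) 0 b
      = -∫ x, pd1 d f x b * pd1 d g x a := by
    intro a b
    have h1 : (fun y => pd1 d (F ⋆[ContinuousLinearMap.mul ℝ ℝ, volume] g) y a) =
        F ⋆[ContinuousLinearMap.mul ℝ ℝ, volume] (fun y => pd1 d g y a) := by
      ext y; exact pd1_convolution_right hFc.continuous hg hcg y a
    rw [h1, pd1_convolution_left hFc (pd1_continuous hg a) hFs, convolution_def,
      ← integral_neg_eq_self]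
    simp [hFd, integral_neg]
  exact neg_injective ((key i j).symm.trans (key' i j))

end Calculus

section ConstantCoefficients

variable {d : ℕ}

local notation "𝔼" => EuclideanSpace ℝ (Fin d)

/-- The squared Euclidean length of the gradient. -/
def gradSq (w : EuclideanSpace ℝ (Fin d) → ℝ) (x : EuclideanSpace ℝ (Fin d)) : ℝ :=
  ∑ i, pd1 d w x i ^ 2

/-- The squared Frobenius norm of the Hessian. -/
def hessSq (w : EuclideanSpace ℝ (Fin d) → ℝ) (x : EuclideanSpace ℝ (Fin d)) : ℝ :=
  ∑ i, ∑ j, pd2 d w x i j ^ 2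

lemma gradSq_nonneg (w : 𝔼 → ℝ) (x : 𝔼) : 0 ≤ gradSq w x :=
  Finset.sum_nonneg fun _ _ => sq_nonneg _

lemma hessSq_nonneg (w : 𝔼 → ℝ) (x : 𝔼) : 0 ≤ hessSq w x :=
  Finset.sum_nonneg fun _ _ => Finset.sum_nonneg fun _ _ => sq_nonneg _

lemma gradSq_continuous {w : 𝔼 → ℝ} (hw : ContDiff ℝ 1 w) : Continuous (gradSq w) :=
  continuous_finsetSum _ fun i _ => (pd1_continuous hw i).pow 2

lemma hessSq_continuous {w : 𝔼 → ℝ} (hw : ContDiff ℝ 2 w) : Continuous (hessSq w) :=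
  continuous_finsetSum _ fun i _ => continuous_finsetSum _ fun j _ => (pd2_continuous hw i j).pow 2

lemma gradSq_hasCompactSupport {w : 𝔼 → ℝ} (hw : HasCompactSupport w) :
    HasCompactSupport (gradSq w) := by
  refine (hw.fderiv ℝ).mono' ?_
  intro x hx
  refine subset_tsupport _ fun h => hx ?_
  simp [gradSq, pd1, h]

lemma hessSq_hasCompactSupport {w : 𝔼 → ℝ} (hw : HasCompactSupport w) :
    HasCompactSupport (hessSq w) := by
  have h : ∀ s : Finset (Fin d × Fin d),
      HasCompactSupport fun x => ∑ p ∈ s, pd2 d w x p.1 p.2 ^ 2 := by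
    intro s
    induction s using Finset.cons_induction with
    | empty => exact HasCompactSupport.zero
    | cons a s ha ih =>
      simp only [Finset.sum_cons]
      refine HasCompactSupport.add ?_ ih
      exact (pd2_hasCompactSupport hw a.1 a.2).comp_left (g := fun t : ℝ => t ^ 2) (by simp)
  have h2 := h Finset.univ
  simp only [Fintype.sum_prod_type] at h2
  exact h2

open scoped MatrixOrder ComplexOrder in
lemma sq_mul_sum_sq_le_trace {A X : Matrix (Fin d) (Fin d) ℝ} {c : ℝ} (hc : 0 ≤ c)
    (hA : ∀ i j, A i j = A j i) (hX : ∀ i j, X i j = X j i)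
    (hell : ∀ ξ : Fin d → ℝ, c * ∑ i, ξ i ^ 2 ≤ ∑ i, ∑ j, ξ i * A i j * ξ j) :
    c ^ 2 * ∑ i, ∑ j, X i j ^ 2 ≤ (A * X * A * X).trace := by
  have hXt : X.transpose = X := by ext i j; exact hX j i
  set P : Matrix (Fin d) (Fin d) ℝ := A - c • (1 : Matrix (Fin d) (Fin d) ℝ) with hP
  have hAP : A = P + c • (1 : Matrix (Fin d) (Fin d) ℝ) := by simp [hP]
  have hpsd : P.PosSemidef := by
    refine Matrix.PosSemidef.of_dotProduct_mulVec_nonneg ?_ fun ξ => ?_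
    · ext i j
      simp [hP, Matrix.one_apply, hA j i, eq_comm]
    · have h := hell ξ
      have h1 : ξ ⬝ᵥ A.mulVec ξ = ∑ i, ∑ j, ξ i * A i j * ξ j := by
        simp [dotProduct, Matrix.mulVec, Finset.mul_sum, mul_assoc]
      have h2 : ξ ⬝ᵥ ξ = ∑ i, ξ i ^ 2 := by simp [dotProduct, sq]
      simp only [hP, star_trivial, Matrix.sub_mulVec, Matrix.smul_mulVec, Matrix.one_mulVec,
        dotProduct_sub, dotProduct_smul, smul_eq_mul, h1, h2]
      linarith
  obtain ⟨Q, hQ⟩ : ∃ Q : Matrix (Fin d) (Fin d) ℝ, P = Q.conjTranspose * Q :=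
    CStarAlgebra.nonneg_iff_eq_star_mul_self.mp hpsd.nonneg
  rw [Matrix.conjTranspose_eq_transpose_of_trivial] at hQ
  have hsum : ∀ M : Matrix (Fin d) (Fin d) ℝ, 0 ≤ (M.transpose * M).trace := by
    intro M
    simp only [Matrix.trace, Matrix.diag, Matrix.mul_apply, Matrix.transpose_apply]
    exact Finset.sum_nonneg fun _ _ => Finset.sum_nonneg fun _ _ => mul_self_nonneg _
  have h1 : (X * X).trace = ∑ i, ∑ j, X i j ^ 2 := by
    simp only [Matrix.trace, Matrix.diag, Matrix.mul_apply, sq]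
    exact Finset.sum_congr rfl fun i _ => Finset.sum_congr rfl fun j _ => by rw [hX j i]
  have h2 : 0 ≤ (P * X * X).trace := by
    have h := hsum (Q * X)
    rw [Matrix.transpose_mul, hXt, Matrix.mul_assoc, ← Matrix.mul_assoc Q.transpose, ← hQ,
      Matrix.trace_mul_comm] at h
    exact h
  have h3 : 0 ≤ (P * X * P * X).trace := by
    have h := hsum (Q * X * Q.transpose)
    rw [Matrix.transpose_mul, Matrix.transpose_mul, hXt, Matrix.transpose_transpose] at h
    have e : Q * (X * Q.transpose) * (Q * X * Q.transpose) =
        Q * (X * P * X * Q.transpose) := by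
      rw [hQ]; simp only [Matrix.mul_assoc]
    rw [e, Matrix.trace_mul_comm] at h
    have e2 : X * P * X * Q.transpose * Q = X * P * X * P := by
      rw [Matrix.mul_assoc _ Q.transpose, ← hQ]
    rw [e2] at h
    have e3 : (P * X * P * X).trace = (X * P * X * P).trace := by
      rw [show P * X * P * X = P * (X * P * X) by simp only [Matrix.mul_assoc],
        Matrix.trace_mul_comm]
    rw [e3]; exact h
  have h4 : (A * X * A * X).trace =
      (P * X * P * X).trace + 2 * c * (P * X * X).trace + c ^ 2 * (X * X).trace := by
    have e : A * X * A * X =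
        P * X * P * X + c • (P * X * X) + c • (X * (P * X)) + (c * c) • (X * X) := by
      rw [hAP]
      simp only [Matrix.add_mul, Matrix.mul_add, Matrix.smul_mul, Matrix.mul_smul, Matrix.one_mul,
        Matrix.mul_one, smul_add, smul_smul, Matrix.mul_assoc]
      abel
    have e5 : (X * (P * X)).trace = (P * X * X).trace := Matrix.trace_mul_comm _ _
    rw [e, Matrix.trace_add, Matrix.trace_add, Matrix.trace_add, Matrix.trace_smul,
      Matrix.trace_smul, Matrix.trace_smul, e5]
    simp only [smul_eq_mul]
    ring
  rw [h4, h1]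
  nlinarith [mul_nonneg hc h2]

lemma trace_mul_mul_mul_eq_sum {A X : Fin d → Fin d → ℝ} (hX : ∀ i j, X i j = X j i) :
    (Matrix.of A * Matrix.of X * Matrix.of A * Matrix.of X).trace =
      ∑ i, ∑ j, ∑ k, ∑ l, A i j * A k l * (X k j * X i l) := by
  rw [Matrix.mul_assoc, Matrix.mul_assoc]
  simp only [Matrix.trace, Matrix.diag, Matrix.mul_apply, Matrix.of_apply, Finset.mul_sum]
  refine Finset.sum_congr rfl fun i _ => Finset.sum_congr rfl fun j _ =>
    Finset.sum_congr rfl fun k _ => Finset.sum_congr rfl fun l _ => ?_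
  rw [hX j k, hX l i]
  ring

lemma integral_sum_sum {f : Fin d → Fin d → 𝔼 → ℝ} (hf : ∀ i j, Integrable (f i j)) :
    ∫ x, ∑ i, ∑ j, f i j x = ∑ i, ∑ j, ∫ x, f i j x := by
  rw [integral_finsetSum _ fun i _ => integrable_finsetSum _ fun j _ => hf i j]
  exact Finset.sum_congr rfl fun i _ => integral_finsetSum _ fun j _ => hf i j

lemma integrable_sum_sum {f : Fin d → Fin d → 𝔼 → ℝ} (hf : ∀ i j, Integrable (f i j)) :
    Integrable fun x => ∑ i, ∑ j, f i j x :=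
  integrable_finsetSum _ fun i _ => integrable_finsetSum _ fun j _ => hf i j

lemma integrable_pd2_mul_pd2 {u : 𝔼 → ℝ} (hu : ContDiff ℝ 2 u) (hs : HasCompactSupport u)
    (i j k l : Fin d) : Integrable fun x => pd2 d u x i j * pd2 d u x k l :=
  ((pd2_continuous hu i j).mul (pd2_continuous hu k l)).integrable_of_hasCompactSupport
    (pd2_hasCompactSupport hs i j).mul_right

lemma integrable_pd1_mul_pd1 {u : 𝔼 → ℝ} (hu : ContDiff ℝ 1 u) (hs : HasCompactSupport u)
    (i j : Fin d) : Integrable fun x => pd1 d u x i * pd1 d u x j :=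
  ((pd1_continuous hu i).mul (pd1_continuous hu j)).integrable_of_hasCompactSupport
    (pd1_hasCompactSupport hs i).mul_right

lemma integral_mul_contraction {u : 𝔼 → ℝ} (hu : ContDiff ℝ 2 u) (hs : HasCompactSupport u)
    (A : Fin d → Fin d → ℝ) :
    ∫ x, u x * ∑ i, ∑ j, A i j * pd2 d u x i j =
      -∫ x, ∑ i, ∑ j, A i j * (pd1 d u x i * pd1 d u x j) := by
  have hu1 : ContDiff ℝ 1 u := hu.of_le (by norm_num)
  have i12 : ∀ i j, Integrable fun x => u x * pd2 d u x i j := fun i j =>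
    (hu.continuous.mul (pd2_continuous hu i j)).integrable_of_hasCompactSupport hs.mul_right
  have i11 := integrable_pd1_mul_pd1 hu1 hs
  have e : (fun x => u x * ∑ i, ∑ j, A i j * pd2 d u x i j) =
      fun x => ∑ i, ∑ j, A i j * (u x * pd2 d u x i j) := by
    ext x
    simp only [Finset.mul_sum]
    exact Finset.sum_congr rfl fun i _ => Finset.sum_congr rfl fun j _ => by ring
  rw [e, integral_sum_sum fun i j => (i12 i j).const_mul _,
    integral_sum_sum fun i j => (i11 i j).const_mul _, ← Finset.sum_neg_distrib]
  refine Finset.sum_congr rfl fun i _ => ?_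
  rw [← Finset.sum_neg_distrib]
  refine Finset.sum_congr rfl fun j _ => ?_
  rw [integral_const_mul, integral_const_mul, ← mul_neg]
  congr 1
  exact integral_mul_pd1_eq_neg hu1 (pd1_contDiff_one hu j) hs i

lemma contraction_sq (A X : Fin d → Fin d → ℝ) :
    (∑ i, ∑ j, A i j * X i j) ^ 2 =
      ∑ i, ∑ j, ∑ k, ∑ l, A i j * A k l * (X i j * X k l) := by
  simp only [sq, Finset.sum_mul, Finset.mul_sum]
  exact Finset.sum_congr rfl fun i _ => Finset.sum_congr rfl fun j _ =>
    Finset.sum_congr rfl fun k _ => Finset.sum_congr rfl fun l _ => by ring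

lemma integral_contraction_sq {u : 𝔼 → ℝ} (hu : ContDiff ℝ 2 u) (hs : HasCompactSupport u)
    (A : Fin d → Fin d → ℝ) :
    ∫ x, (∑ i, ∑ j, A i j * pd2 d u x i j) ^ 2 =
      ∫ x, (Matrix.of A * hessian d u x * Matrix.of A * hessian d u x).trace := by
  have e1 : (fun x => (∑ i, ∑ j, A i j * pd2 d u x i j) ^ 2) = fun x =>
      ∑ i, ∑ j, ∑ k, ∑ l, A i j * A k l * (pd2 d u x i j * pd2 d u x k l) :=
    funext fun x => contraction_sq A (pd2 d u x)
  have e2 : (fun x => (Matrix.of A * hessian d u x * Matrix.of A * hessian d u x).trace) = fun x =>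
      ∑ i, ∑ j, ∑ k, ∑ l, A i j * A k l * (pd2 d u x k j * pd2 d u x i l) :=
    funext fun x => trace_mul_mul_mul_eq_sum (X := pd2 d u x) fun i j => pd2_symm hu x i j
  have i1 : ∀ i j k l, Integrable fun x => A i j * A k l * (pd2 d u x i j * pd2 d u x k l) :=
    fun i j k l => (integrable_pd2_mul_pd2 hu hs i j k l).const_mul _
  have i2 : ∀ i j k l, Integrable fun x => A i j * A k l * (pd2 d u x k j * pd2 d u x i l) :=
    fun i j k l => (integrable_pd2_mul_pd2 hu hs k j i l).const_mul _
  rw [e1, e2, integral_sum_sum fun i j => integrable_sum_sum fun k l => i1 i j k l,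
    integral_sum_sum fun i j => integrable_sum_sum fun k l => i2 i j k l]
  refine Finset.sum_congr rfl fun i _ => Finset.sum_congr rfl fun j _ => ?_
  rw [integral_sum_sum fun k l => i1 i j k l, integral_sum_sum fun k l => i2 i j k l]
  refine Finset.sum_congr rfl fun k _ => Finset.sum_congr rfl fun l _ => ?_
  rw [integral_const_mul, integral_const_mul]
  congr 1
  exact integral_pd1_mul_pd1_comm (pd1_contDiff_one hu j) (pd1_contDiff_one hu l)
    (pd1_hasCompactSupport hs j) (pd1_hasCompactSupport hs l) i k

lemma integrable_trace {u : 𝔼 → ℝ} (hu : ContDiff ℝ 2 u) (hs : HasCompactSupport u)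
    (A : Fin d → Fin d → ℝ) :
    Integrable fun x => (Matrix.of A * hessian d u x * Matrix.of A * hessian d u x).trace := by
  have e2 : (fun x => (Matrix.of A * hessian d u x * Matrix.of A * hessian d u x).trace) = fun x =>
      ∑ i, ∑ j, ∑ k, ∑ l, A i j * A k l * (pd2 d u x k j * pd2 d u x i l) :=
    funext fun x => trace_mul_mul_mul_eq_sum (X := pd2 d u x) fun i j => pd2_symm hu x i j
  rw [e2]
  exact integrable_sum_sum fun i j => integrable_sum_sum fun k l =>
    (integrable_pd2_mul_pd2 hu hs k j i l).const_mul _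

lemma integrable_contraction_sq {u : 𝔼 → ℝ} (hu : ContDiff ℝ 2 u) (hs : HasCompactSupport u)
    (A : Fin d → Fin d → ℝ) :
    Integrable fun x => (∑ i, ∑ j, A i j * pd2 d u x i j) ^ 2 := by
  have e1 : (fun x => (∑ i, ∑ j, A i j * pd2 d u x i j) ^ 2) = fun x =>
      ∑ i, ∑ j, ∑ k, ∑ l, A i j * A k l * (pd2 d u x i j * pd2 d u x k l) :=
    funext fun x => contraction_sq A (pd2 d u x)
  rw [e1]
  exact integrable_sum_sum fun i j => integrable_sum_sum fun k l =>
    (integrable_pd2_mul_pd2 hu hs i j k l).const_mul _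

lemma integrable_gradSq {u : 𝔼 → ℝ} (hu : ContDiff ℝ 1 u) (hs : HasCompactSupport u) :
    Integrable (gradSq u) :=
  (gradSq_continuous hu).integrable_of_hasCompactSupport (gradSq_hasCompactSupport hs)

lemma integrable_hessSq {u : 𝔼 → ℝ} (hu : ContDiff ℝ 2 u) (hs : HasCompactSupport u) :
    Integrable (hessSq u) :=
  (hessSq_continuous hu).integrable_of_hasCompactSupport (hessSq_hasCompactSupport hs)

lemma integral_sub_sq {u T : 𝔼 → ℝ} {ρ : ℝ} (iuu : Integrable fun x => u x ^ 2)
    (iuT : Integrable fun x => u x * T x) (iTT : Integrable fun x => T x ^ 2) :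
    ∫ x, (ρ * u x - 1 / 2 * T x) ^ 2 =
      ρ ^ 2 * (∫ x, u x ^ 2) - ρ * (∫ x, u x * T x) + 1 / 4 * ∫ x, T x ^ 2 := by
  have h1 : Integrable fun x => ρ ^ 2 * u x ^ 2 - ρ * (u x * T x) :=
    (iuu.const_mul _).sub (iuT.const_mul _)
  rw [← integral_const_mul, ← integral_const_mul, ← integral_const_mul,
    ← integral_sub (iuu.const_mul _) (iuT.const_mul _), ← integral_add h1 (iTT.const_mul _)]
  congr 1
  ext x
  ring

lemma mul_integral_gradSq_le {u : 𝔼 → ℝ} (hu : ContDiff ℝ 1 u) (hs : HasCompactSupport u)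
    {A : Fin d → Fin d → ℝ} {c : ℝ}
    (hell : ∀ ξ : Fin d → ℝ, c * ∑ i, ξ i ^ 2 ≤ ∑ i, ∑ j, ξ i * A i j * ξ j) :
    c * ∫ x, gradSq u x ≤ ∫ x, ∑ i, ∑ j, A i j * (pd1 d u x i * pd1 d u x j) := by
  rw [← integral_const_mul]
  refine integral_mono ((integrable_gradSq hu hs).const_mul _) (integrable_sum_sum fun i j =>
    (integrable_pd1_mul_pd1 hu hs i j).const_mul _) fun x => ?_
  refine (hell fun i => pd1 d u x i).trans (le_of_eq ?_)
  exact Finset.sum_congr rfl fun i _ => Finset.sum_congr rfl fun j _ => by ring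

lemma mul_integral_hessSq_le {u : 𝔼 → ℝ} (hu : ContDiff ℝ 2 u) (hs : HasCompactSupport u)
    {A : Fin d → Fin d → ℝ} {c : ℝ} (hc : 0 ≤ c) (hA : ∀ i j, A i j = A j i)
    (hell : ∀ ξ : Fin d → ℝ, c * ∑ i, ξ i ^ 2 ≤ ∑ i, ∑ j, ξ i * A i j * ξ j) :
    c ^ 2 * ∫ x, hessSq u x ≤
      ∫ x, (Matrix.of A * hessian d u x * Matrix.of A * hessian d u x).trace := by
  rw [← integral_const_mul]
  refine integral_mono ((integrable_hessSq hu hs).const_mul _) (integrable_trace hu hs A)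
    fun x => ?_
  exact sq_mul_sum_sq_le_trace (A := Matrix.of A) (X := hessian d u x) hc hA
    (fun i j => pd2_symm hu x i j) hell

lemma integrable_sq_of_hasCompactSupport {u : 𝔼 → ℝ} (hu : Continuous u)
    (hs : HasCompactSupport u) : Integrable fun x => u x ^ 2 := by
  simp only [sq]
  exact (hu.mul hu).integrable_of_hasCompactSupport hs.mul_right

/-- The energy and Hessian estimate for `ρ u - ½ tr(A D²u)` with a constant symmetric elliptic
matrix `A`, for compactly supported `C²` functions. -/
lemma constant_coefficient_estimate {u : 𝔼 → ℝ} (hu : ContDiff ℝ 2 u) (hs : HasCompactSupport u)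
    {A : Fin d → Fin d → ℝ} {c ρ : ℝ} (hc : 0 ≤ c) (hρ : 0 ≤ ρ)
    (hA : ∀ i j, A i j = A j i)
    (hell : ∀ ξ : Fin d → ℝ, c * ∑ i, ξ i ^ 2 ≤ ∑ i, ∑ j, ξ i * A i j * ξ j) :
    ρ ^ 2 * (∫ x, u x ^ 2) + c * ρ * (∫ x, gradSq u x) + c ^ 2 / 4 * (∫ x, hessSq u x) ≤
      ∫ x, (ρ * u x - 1 / 2 * ∑ i, ∑ j, A i j * pd2 d u x i j) ^ 2 := by
  have hu1 : ContDiff ℝ 1 u := hu.of_le (by norm_num)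
  have hTT := integral_contraction_sq hu hs A
  have huT := integral_mul_contraction hu hs A
  have iTT := integrable_contraction_sq hu hs A
  have hTc : Continuous fun x => ∑ i, ∑ j, A i j * pd2 d u x i j :=
    continuous_finsetSum _ fun i _ => continuous_finsetSum _ fun j _ =>
      continuous_const.mul (pd2_continuous hu i j)
  have iuT : Integrable fun x => u x * ∑ i, ∑ j, A i j * pd2 d u x i j :=
    (hu.continuous.mul hTc).integrable_of_hasCompactSupport hs.mul_right
  have iuu : Integrable fun x => u x ^ 2 :=
    integrable_sq_of_hasCompactSupport hu.continuous hs
  have hgrad := mul_integral_gradSq_le hu1 hs hell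
  have hhess := mul_integral_hessSq_le hu hs hc hA hell
  have key := integral_sub_sq (ρ := ρ) iuu iuT iTT
  rw [huT, hTT] at key
  refine le_of_le_of_eq ?_ key.symm
  have h := mul_le_mul_of_nonneg_left hgrad hρ
  generalize (∫ x, ∑ i, ∑ j, A i j * (pd1 d u x i * pd1 d u x j)) = a1 at *
  generalize (∫ x, (Matrix.of A * hessian d u x * Matrix.of A * hessian d u x).trace) = a2 at *
  generalize (∫ x, gradSq u x) = a3 at *
  generalize (∫ x, hessSq u x) = a4 at *
  generalize (∫ x, u x ^ 2) = a5 at *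
  linarith

end ConstantCoefficients

section LocalEstimate

variable {d : ℕ}

local notation "𝔼" => EuclideanSpace ℝ (Fin d)

/-- A `C²` cutoff function supported in the bounded open set `s`, with gradient and Hessian
controlled by `K`. -/
structure IsCutoff (K : ℝ) (s : Set (EuclideanSpace ℝ (Fin d)))
    (ζ : EuclideanSpace ℝ (Fin d) → ℝ) : Prop where
  contDiff : ContDiff ℝ 2 ζ
  hasCompactSupport : HasCompactSupport ζ
  nonneg : ∀ x, 0 ≤ ζ x
  le_one : ∀ x, ζ x ≤ 1
  gradSq_le : ∀ x, gradSq ζ x ≤ K * ζ x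
  hessSq_le : ∀ x, hessSq ζ x ≤ K
  tsupport_subset : tsupport ζ ⊆ s

lemma sq_sum_abs_pd1_le (w : 𝔼 → ℝ) (x : 𝔼) : (∑ i, |pd1 d w x i|) ^ 2 ≤ d * gradSq w x := by
  simpa [gradSq] using sq_sum_le_card_mul_sum_sq (s := Finset.univ) (f := fun i => |pd1 d w x i|)

lemma sq_sum_abs_pd2_le (w : 𝔼 → ℝ) (x : 𝔼) :
    (∑ i, ∑ j, |pd2 d w x i j|) ^ 2 ≤ d ^ 2 * hessSq w x := by
  have h := sq_sum_le_card_mul_sum_sq (s := (Finset.univ : Finset (Fin d × Fin d)))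
    (f := fun p => |pd2 d w x p.1 p.2|)
  simpa [hessSq, Fintype.sum_prod_type, sq] using h

lemma sq_laplacian_le (w : 𝔼 → ℝ) (x : 𝔼) : (∑ i, pd2 d w x i i) ^ 2 ≤ d * hessSq w x := by
  have h := sq_sum_le_card_mul_sum_sq (s := Finset.univ) (f := fun i => pd2 d w x i i)
  have h2 : ∑ i, pd2 d w x i i ^ 2 ≤ hessSq w x := Finset.sum_le_sum fun i _ =>
    Finset.single_le_sum (f := fun j => pd2 d w x i j ^ 2) (fun j _ => sq_nonneg _)
      (Finset.mem_univ i)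
  simp only [Finset.card_univ, Fintype.card_fin] at h
  exact h.trans (by gcongr)

lemma tsupport_pd1_subset (w : 𝔼 → ℝ) (i : Fin d) :
    tsupport (fun x => pd1 d w x i) ⊆ tsupport w :=
  tsupport_fderiv_apply_subset ℝ _

lemma pd1_eq_zero_of_notMem {w : 𝔼 → ℝ} {x : 𝔼} (hx : x ∉ tsupport w) (i : Fin d) :
    pd1 d w x i = 0 :=
  image_eq_zero_of_notMem_tsupport (f := fun y => pd1 d w y i)
    fun h => hx (tsupport_pd1_subset w i h)

lemma pd2_eq_zero_of_notMem {w : 𝔼 → ℝ} {x : 𝔼} (hx : x ∉ tsupport w) (i j : Fin d) :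
    pd2 d w x i j = 0 :=
  pd1_eq_zero_of_notMem (fun h => hx (tsupport_pd1_subset w j h)) i

lemma gradSq_eq_zero_of_notMem {w : 𝔼 → ℝ} {x : 𝔼} (hx : x ∉ tsupport w) : gradSq w x = 0 := by
  simp [gradSq, pd1_eq_zero_of_notMem hx]

lemma hessSq_eq_zero_of_notMem {w : 𝔼 → ℝ} {x : 𝔼} (hx : x ∉ tsupport w) : hessSq w x = 0 := by
  simp [hessSq, pd2_eq_zero_of_notMem hx]

lemma setIntegral_eq_integral_of_tsupport {s : Set 𝔼} {ζ f : 𝔼 → ℝ} (hs : tsupport ζ ⊆ s)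
    (hf : ∀ x, x ∉ tsupport ζ → f x = 0) : ∫ x in s, f x = ∫ x, f x :=
  setIntegral_eq_integral_of_forall_compl_eq_zero fun x hx => hf x fun h => hx (hs h)

lemma integrableOn_of_isBounded {s : Set 𝔼} (hs : Bornology.IsBounded s) {f : 𝔼 → ℝ}
    (hf : Continuous f) : IntegrableOn f s :=
  (hf.continuousOn.integrableOn_compact hs.isCompact_closure).mono_set subset_closure

lemma setIntegral_le_combination {s : Set 𝔼} (hb : Bornology.IsBounded s)
    (hs : MeasurableSet s) {f g₁ g₂ g₃ g₄ : 𝔼 → ℝ} (hf : Continuous f) (h₁ : Continuous g₁)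
    (h₂ : Continuous g₂) (h₃ : Continuous g₃) (h₄ : Continuous g₄) (a₁ a₂ a₃ a₄ : ℝ)
    (h : ∀ x ∈ s, f x ≤ a₁ * g₁ x + a₂ * g₂ x + a₃ * g₃ x + a₄ * g₄ x) :
    ∫ x in s, f x ≤ a₁ * (∫ x in s, g₁ x) + a₂ * (∫ x in s, g₂ x) + a₃ * (∫ x in s, g₃ x) +
      a₄ * ∫ x in s, g₄ x := by
  have i := fun {g : 𝔼 → ℝ} (hg : Continuous g) => integrableOn_of_isBounded hb hg
  have i1 := (i h₁).const_mul a₁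
  have i2 := (i h₂).const_mul a₂
  have i3 := (i h₃).const_mul a₃
  have i4 := (i h₄).const_mul a₄
  have i12 : Integrable (fun x => a₁ * g₁ x + a₂ * g₂ x) (volume.restrict s) := i1.add i2
  have i123 : Integrable (fun x => a₁ * g₁ x + a₂ * g₂ x + a₃ * g₃ x) (volume.restrict s) :=
    i12.add i3
  refine (setIntegral_mono_on (i hf) (i123.add i4) hs h).trans (le_of_eq ?_)
  simp only [Pi.add_apply]
  rw [integral_add i123 i4, integral_add i12 i3, integral_add i1 i2]
  simp only [integral_const_mul]

lemma setIntegral_le_combination₃ {s : Set 𝔼} (hb : Bornology.IsBounded s)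
    (hs : MeasurableSet s) {f g₁ g₂ g₃ : 𝔼 → ℝ} (hf : Continuous f) (h₁ : Continuous g₁)
    (h₂ : Continuous g₂) (h₃ : Continuous g₃) (a₁ a₂ a₃ : ℝ)
    (h : ∀ x ∈ s, f x ≤ a₁ * g₁ x + a₂ * g₂ x + a₃ * g₃ x) :
    ∫ x in s, f x ≤ a₁ * (∫ x in s, g₁ x) + a₂ * (∫ x in s, g₂ x) + a₃ * ∫ x in s, g₃ x := by
  simpa using setIntegral_le_combination hb hs hf h₁ h₂ h₃ continuous_zero a₁ a₂ a₃ 0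
    (by simpa using h)

/-- Integration by parts identity behind the interpolation inequality. -/
lemma integral_cutoff_identity {w ζ : 𝔼 → ℝ} (hw : ContDiff ℝ 2 w) (hζ : ContDiff ℝ 2 ζ)
    (hs : HasCompactSupport ζ) :
    ∫ x, (ζ x * w x * ∑ i, pd2 d w x i i + ζ x * gradSq w x
      + w x * ∑ i, pd1 d ζ x i * pd1 d w x i) = 0 := by
  have hw1 : ContDiff ℝ 1 w := hw.of_le (by norm_num)
  have hζ1 : ContDiff ℝ 1 ζ := hζ.of_le (by norm_num)
  have hz : ContDiff ℝ 1 fun x => ζ x * w x := hζ1.mul hw1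
  have hzs : HasCompactSupport fun x => ζ x * w x := hs.mul_right
  have e : (fun x => ζ x * w x * ∑ i, pd2 d w x i i + ζ x * gradSq w x
      + w x * ∑ i, pd1 d ζ x i * pd1 d w x i) = fun x => ∑ i,
      (ζ x * w x * pd2 d w x i i + pd1 d (fun y => ζ y * w y) x i * pd1 d w x i) := by
    ext x
    simp only [gradSq, Finset.mul_sum, ← Finset.sum_add_distrib]
    refine Finset.sum_congr rfl fun i _ => ?_
    rw [pd1_mul (hζ1.differentiable (by norm_num) x) (hw1.differentiable (by norm_num) x)]
    ring
  have i1 : ∀ i, Integrable fun x => ζ x * w x * pd2 d w x i i := fun i =>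
    (hz.continuous.mul (pd2_continuous hw i i)).integrable_of_hasCompactSupport hzs.mul_right
  have i2 : ∀ i, Integrable fun x => pd1 d (fun y => ζ y * w y) x i * pd1 d w x i := fun i =>
    ((pd1_continuous hz i).mul (pd1_continuous hw1 i)).integrable_of_hasCompactSupport
      (pd1_hasCompactSupport hzs i).mul_right
  have i3 : ∀ i, Integrable fun x => ζ x * w x * pd2 d w x i i +
      pd1 d (fun y => ζ y * w y) x i * pd1 d w x i := fun i => (i1 i).add (i2 i)
  rw [e, integral_finsetSum _ fun i _ => i3 i]
  refine Finset.sum_eq_zero fun i _ => ?_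
  rw [integral_add (i1 i) (i2 i)]
  have h := integral_mul_pd1_eq_neg hz (pd1_contDiff_one hw i) hzs i
  simp only [← pd2_eq_pd1] at h
  rw [h]
  ring

lemma interpolation_pointwise {w ζ : 𝔼 → ℝ} {s : Set 𝔼} {K κ : ℝ} (hK : 0 < K) (hκ : 0 < κ)
    (hζ : IsCutoff K s ζ) (x : 𝔼) :
    ζ x * gradSq w x ≤ 2 * (ζ x * w x * ∑ i, pd2 d w x i i + ζ x * gradSq w x
      + w x * ∑ i, pd1 d ζ x i * pd1 d w x i) + κ * d * (ζ x ^ 2 * hessSq w x)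
      + (1 / κ + K) * w x ^ 2 := by
  have h1 := sq_laplacian_le w x
  have h2 : (∑ i, pd1 d ζ x i * pd1 d w x i) ^ 2 ≤ K * ζ x * gradSq w x := by
    refine (Finset.sum_mul_sq_le_sq_mul_sq _ _ _).trans ?_
    exact mul_le_mul_of_nonneg_right (hζ.gradSq_le x) (gradSq_nonneg w x)
  set L := ∑ i, pd2 d w x i i
  set T := ∑ i, pd1 d ζ x i * pd1 d w x i
  have h3 : -2 * (ζ x * w x * L) ≤ κ * d * (ζ x ^ 2 * hessSq w x) + 1 / κ * w x ^ 2 := by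
    have h : 0 ≤ (κ * ζ x * L + w x) ^ 2 / κ := by positivity
    have e : (κ * ζ x * L + w x) ^ 2 / κ =
        κ * ζ x ^ 2 * L ^ 2 + 2 * (ζ x * w x * L) + 1 / κ * w x ^ 2 := by
      field_simp
      ring
    have h' : κ * ζ x ^ 2 * L ^ 2 ≤ κ * ζ x ^ 2 * (d * hessSq w x) := by gcongr
    rw [e] at h
    linarith
  have h4 : -2 * (w x * T) ≤ ζ x * gradSq w x + K * w x ^ 2 := by
    have h : 0 ≤ (T + K * w x) ^ 2 / K := by positivity
    have e : (T + K * w x) ^ 2 / K = T ^ 2 / K + 2 * (w x * T) + K * w x ^ 2 := by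
      field_simp
      ring
    have h' : T ^ 2 / K ≤ ζ x * gradSq w x := by
      rw [div_le_iff₀ hK]
      linarith
    rw [e] at h
    linarith
  linarith

lemma interpolation {w ζ : 𝔼 → ℝ} {s : Set 𝔼} {K κ : ℝ} (hK : 0 < K) (hκ : 0 < κ)
    (hb : Bornology.IsBounded s) (hsm : MeasurableSet s) (hw : ContDiff ℝ 2 w)
    (hζ : IsCutoff K s ζ) :
    ∫ x in s, ζ x * gradSq w x ≤
      κ * d * (∫ x in s, ζ x ^ 2 * hessSq w x) + (1 / κ + K) * ∫ x in s, w x ^ 2 := by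
  have hw1 : ContDiff ℝ 1 w := hw.of_le (by norm_num)
  have hζ1 : ContDiff ℝ 1 ζ := hζ.contDiff.of_le (by norm_num)
  have h0 := integral_cutoff_identity hw hζ.contDiff hζ.hasCompactSupport
  rw [← setIntegral_eq_integral_of_tsupport hζ.tsupport_subset] at h0
  swap
  · intro x hx
    simp [image_eq_zero_of_notMem_tsupport hx, pd1_eq_zero_of_notMem hx]
  have cg := gradSq_continuous hw1
  have ch := hessSq_continuous hw
  have hc : Continuous fun x => ζ x * w x * ∑ i, pd2 d w x i i + ζ x * gradSq w x
      + w x * ∑ i, pd1 d ζ x i * pd1 d w x i :=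
    (((hζ1.continuous.mul hw1.continuous).mul (continuous_finsetSum _ fun i _ =>
      pd2_continuous hw i i)).add (hζ1.continuous.mul cg)).add (hw1.continuous.mul
      (continuous_finsetSum _ fun i _ => (pd1_continuous hζ1 i).mul (pd1_continuous hw1 i)))
  have h := setIntegral_le_combination₃ hb hsm (hζ1.continuous.mul cg) hc
    ((hζ1.continuous.pow 2).mul ch) (hw1.continuous.pow 2) 2 (κ * d) (1 / κ + K)
    fun x _ => interpolation_pointwise hK hκ hζ x
  simpa [h0] using h

lemma sq_sum_five_le (a b c e f : ℝ) :
    (a + b + c + e + f) ^ 2 ≤ 5 * (a ^ 2 + b ^ 2 + c ^ 2 + e ^ 2 + f ^ 2) := by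
  nlinarith [sq_nonneg (a - b), sq_nonneg (a - c), sq_nonneg (a - e), sq_nonneg (a - f),
    sq_nonneg (b - c), sq_nonneg (b - e), sq_nonneg (b - f), sq_nonneg (c - e),
    sq_nonneg (c - f), sq_nonneg (e - f)]

lemma gradSq_mul_le {w ζ : 𝔼 → ℝ} {s : Set 𝔼} {K : ℝ} (hw : ContDiff ℝ 2 w)
    (hζ : IsCutoff K s ζ) (x : 𝔼) (hK : 0 < K) :
    ζ x ^ 2 * gradSq w x ≤ 2 * gradSq (fun y => ζ y * w y) x + 2 * K * w x ^ 2 := by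
  have h1 : ζ x ^ 2 * gradSq w x ≤
      2 * gradSq (fun y => ζ y * w y) x + 2 * (w x ^ 2 * gradSq ζ x) := by
    simp only [gradSq, Finset.mul_sum, ← Finset.sum_add_distrib]
    refine Finset.sum_le_sum fun i _ => ?_
    rw [pd1_mul (hζ.contDiff.differentiable (by norm_num) x) (hw.differentiable (by norm_num) x)]
    nlinarith [sq_nonneg (ζ x * pd1 d w x i + 2 * (w x * pd1 d ζ x i))]
  have h2 : w x ^ 2 * gradSq ζ x ≤ w x ^ 2 * K := by
    gcongr
    exact (hζ.gradSq_le x).trans (mul_le_of_le_one_right hK.le (hζ.le_one x))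
  linarith

lemma hessSq_mul_le {w ζ : 𝔼 → ℝ} {s : Set 𝔼} {K : ℝ} (hw : ContDiff ℝ 2 w)
    (hζ : IsCutoff K s ζ) (x : 𝔼) :
    ζ x ^ 2 * hessSq w x ≤ 4 * hessSq (fun y => ζ y * w y) x + 8 * K * (ζ x * gradSq w x)
      + 4 * K * w x ^ 2 := by
  have h1 : ζ x ^ 2 * hessSq w x ≤ 4 * hessSq (fun y => ζ y * w y) x +
      8 * (gradSq ζ x * gradSq w x) + 4 * (w x ^ 2 * hessSq ζ x) := by
    have e : 8 * (gradSq ζ x * gradSq w x) = ∑ i, ∑ j, 4 * (pd1 d ζ x i ^ 2 * pd1 d w x j ^ 2 +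
        pd1 d ζ x j ^ 2 * pd1 d w x i ^ 2) := by
      have e1 : ∑ i, ∑ j, pd1 d ζ x i ^ 2 * pd1 d w x j ^ 2 = gradSq ζ x * gradSq w x := by
        rw [gradSq, gradSq, Finset.sum_mul_sum]
      have e2 : ∑ i, ∑ j, pd1 d ζ x j ^ 2 * pd1 d w x i ^ 2 = gradSq ζ x * gradSq w x := by
        rw [Finset.sum_comm, e1]
      have e3 : 8 * (gradSq ζ x * gradSq w x) =
          4 * ((∑ i, ∑ j, pd1 d ζ x i ^ 2 * pd1 d w x j ^ 2) +
            ∑ i, ∑ j, pd1 d ζ x j ^ 2 * pd1 d w x i ^ 2) := by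
        rw [e1, e2]
        ring
      rw [e3]
      simp only [Finset.mul_sum, mul_add, Finset.sum_add_distrib]
    rw [e]
    simp only [hessSq, Finset.mul_sum, ← Finset.sum_add_distrib]
    refine Finset.sum_le_sum fun i _ => Finset.sum_le_sum fun j _ => ?_
    rw [pd2_mul hζ.contDiff hw]
    set t := ζ x * pd2 d w x i j
    set a := pd1 d ζ x i * pd1 d w x j
    set b := pd1 d ζ x j * pd1 d w x i
    set c := w x * pd2 d ζ x i j
    have : t ^ 2 ≤ 4 * (t + a + b + c) ^ 2 + 4 * (a ^ 2 + b ^ 2) + 4 * c ^ 2 := by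
      have h := sq_sum_five_le (t + a + b + c) (-a) (-b) (-c) 0
      nlinarith [sq_nonneg ((t + a + b + c) + a), sq_nonneg ((t + a + b + c) + b),
        sq_nonneg ((t + a + b + c) + c), sq_nonneg (a - b), sq_nonneg (a - c),
        sq_nonneg (b - c)]
    nlinarith
  have h2 : w x ^ 2 * hessSq ζ x ≤ w x ^ 2 * K := by
    gcongr
    exact hζ.hessSq_le x
  have h3 : gradSq ζ x * gradSq w x ≤ K * ζ x * gradSq w x :=
    mul_le_mul_of_nonneg_right (hζ.gradSq_le x) (gradSq_nonneg w x)
  linarith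

lemma abs_contraction_le {A : Fin d → Fin d → ℝ} {C : ℝ} (hA : ∀ i j, |A i j| ≤ C)
    (f : Fin d → Fin d → ℝ) : |∑ i, ∑ j, A i j * f i j| ≤ C * ∑ i, ∑ j, |f i j| := by
  rw [Finset.mul_sum]
  refine (Finset.abs_sum_le_sum_abs _ _).trans (Finset.sum_le_sum fun i _ => ?_)
  rw [Finset.mul_sum]
  refine (Finset.abs_sum_le_sum_abs _ _).trans (Finset.sum_le_sum fun j _ => ?_)
  rw [abs_mul]
  gcongr
  exact hA i j

lemma abs_commutator_le {w ζ : 𝔼 → ℝ} (hw : ContDiff ℝ 2 w) (hζ : ContDiff ℝ 2 ζ) (x : 𝔼)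
    (hζ0 : 0 ≤ ζ x) {A : Fin d → Fin d → ℝ} {C ρ F : ℝ} (hA : ∀ i j, |A i j| ≤ C)
    (hF : |ρ * w x - 1 / 2 * ∑ i, ∑ j, A i j * pd2 d w x i j| ≤ F) :
    |ρ * (ζ x * w x) - 1 / 2 * ∑ i, ∑ j, A i j * pd2 d (fun y => ζ y * w y) x i j| ≤
      ζ x * F + C * ((∑ i, |pd1 d ζ x i|) * ∑ i, |pd1 d w x i|)
        + 1 / 2 * (C * (|w x| * ∑ i, ∑ j, |pd2 d ζ x i j|)) := by
  have e : ρ * (ζ x * w x) - 1 / 2 * ∑ i, ∑ j, A i j * pd2 d (fun y => ζ y * w y) x i j =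
      ζ x * (ρ * w x - 1 / 2 * ∑ i, ∑ j, A i j * pd2 d w x i j)
      - 1 / 2 * (∑ i, ∑ j, A i j * (pd1 d ζ x i * pd1 d w x j))
      - 1 / 2 * (∑ i, ∑ j, A i j * (pd1 d ζ x j * pd1 d w x i))
      - 1 / 2 * ∑ i, ∑ j, A i j * (w x * pd2 d ζ x i j) := by
    have : ∑ i, ∑ j, A i j * pd2 d (fun y => ζ y * w y) x i j =
        ζ x * (∑ i, ∑ j, A i j * pd2 d w x i j)
        + (∑ i, ∑ j, A i j * (pd1 d ζ x i * pd1 d w x j))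
        + (∑ i, ∑ j, A i j * (pd1 d ζ x j * pd1 d w x i))
        + ∑ i, ∑ j, A i j * (w x * pd2 d ζ x i j) := by
      simp only [Finset.mul_sum, ← Finset.sum_add_distrib]
      refine Finset.sum_congr rfl fun i _ => Finset.sum_congr rfl fun j _ => ?_
      rw [pd2_mul hζ hw]
      ring
    rw [this]
    ring
  have h1 := abs_contraction_le hA fun i j => pd1 d ζ x i * pd1 d w x j
  have h2 := abs_contraction_le hA fun i j => pd1 d ζ x j * pd1 d w x i
  have h3 := abs_contraction_le hA fun i j => w x * pd2 d ζ x i j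
  have s1 : ∑ i, ∑ j, |pd1 d ζ x i * pd1 d w x j| =
      (∑ i, |pd1 d ζ x i|) * ∑ i, |pd1 d w x i| := by
    simp only [abs_mul, Finset.sum_mul_sum]
  have s2 : ∑ i, ∑ j, |pd1 d ζ x j * pd1 d w x i| =
      (∑ i, |pd1 d ζ x i|) * ∑ i, |pd1 d w x i| := by
    rw [Finset.sum_comm, s1]
  have s3 : ∑ i, ∑ j, |w x * pd2 d ζ x i j| = |w x| * ∑ i, ∑ j, |pd2 d ζ x i j| := by
    simp only [abs_mul, Finset.mul_sum]
  rw [s1] at h1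
  rw [s2] at h2
  rw [s3] at h3
  have h0 : |ζ x * (ρ * w x - 1 / 2 * ∑ i, ∑ j, A i j * pd2 d w x i j)| ≤ ζ x * F := by
    rw [abs_mul, abs_of_nonneg hζ0]
    gcongr
  rw [e]
  rw [abs_le] at h0 h1 h2 h3 ⊢
  constructor <;> linarith

lemma sq_commutator_le {w ζ : 𝔼 → ℝ} {s : Set 𝔼} {K : ℝ} (hK : 0 < K) (hw : ContDiff ℝ 2 w)
    (hζ : IsCutoff K s ζ) (x : 𝔼) {A : Fin d → Fin d → ℝ} {C ρ G δ : ℝ}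
    (hA : ∀ i j, |A i j| ≤ C)
    (hF : |ρ * w x - 1 / 2 * ∑ i, ∑ j, A i j * pd2 d w x i j| ≤
      G + C * (∑ i, |pd1 d w x i|) + δ * ∑ i, ∑ j, |pd2 d w x i j|) :
    (ρ * (ζ x * w x) - 1 / 2 * ∑ i, ∑ j, A i j * pd2 d (fun y => ζ y * w y) x i j) ^ 2 ≤
      5 * G ^ 2 + 5 * C ^ 2 * (d + d ^ 2 * K) * (ζ x * gradSq w x)
        + 5 * δ ^ 2 * d ^ 2 * (ζ x ^ 2 * hessSq w x) + 5 * C ^ 2 * d ^ 2 * K * w x ^ 2 := by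
  have h := abs_commutator_le hw hζ.contDiff x (hζ.nonneg x) hA hF
  have hP := sq_sum_abs_pd1_le w x
  have hQ := sq_sum_abs_pd2_le w x
  have hp : (∑ i, |pd1 d ζ x i|) ^ 2 ≤ d * (K * ζ x) :=
    (sq_sum_abs_pd1_le ζ x).trans (by gcongr; exact hζ.gradSq_le x)
  have hq : (∑ i, ∑ j, |pd2 d ζ x i j|) ^ 2 ≤ d ^ 2 * K :=
    (sq_sum_abs_pd2_le ζ x).trans (by gcongr; exact hζ.hessSq_le x)
  have hg := gradSq_nonneg w x
  have hz0 := hζ.nonneg x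
  have hz1 := hζ.le_one x
  have hzz : ζ x ^ 2 ≤ ζ x := by nlinarith
  have hz2 : ζ x ^ 2 ≤ 1 := hzz.trans hz1
  generalize (∑ i, |pd1 d w x i|) = P at *
  generalize (∑ i, ∑ j, |pd2 d w x i j|) = Q at *
  generalize (∑ i, |pd1 d ζ x i|) = p at *
  generalize (∑ i, ∑ j, |pd2 d ζ x i j|) = q at *
  generalize hessSq w x = H at *
  generalize gradSq w x = g at *
  generalize (ρ * (ζ x * w x) - 1 / 2 * ∑ i, ∑ j, A i j * pd2 d (fun y => ζ y * w y) x i j) = f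
    at *
  have hdK : 0 ≤ (d : ℝ) * (K * ζ x) := by positivity
  calc f ^ 2 = |f| ^ 2 := (sq_abs f).symm
    _ ≤ (ζ x * G + ζ x * (C * P) + ζ x * (δ * Q) + C * (p * P) +
          1 / 2 * (C * (|w x| * q))) ^ 2 := by
        refine pow_le_pow_left₀ (abs_nonneg f) (h.trans (le_of_eq ?_)) 2
        ring
    _ ≤ 5 * ((ζ x * G) ^ 2 + (ζ x * (C * P)) ^ 2 + (ζ x * (δ * Q)) ^ 2 + (C * (p * P)) ^ 2
          + (1 / 2 * (C * (|w x| * q))) ^ 2) := sq_sum_five_le _ _ _ _ _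
    _ = 5 * (ζ x ^ 2 * G ^ 2 + C ^ 2 * (ζ x ^ 2 * P ^ 2) + δ ^ 2 * (ζ x ^ 2 * Q ^ 2)
          + C ^ 2 * (p ^ 2 * P ^ 2) + 1 / 4 * (C ^ 2 * (w x ^ 2 * q ^ 2))) := by
        have := sq_abs (w x)
        simp only [mul_pow, this]
        ring
    _ ≤ 5 * (1 * G ^ 2 + C ^ 2 * (ζ x * (d * g)) + δ ^ 2 * (ζ x ^ 2 * (d ^ 2 * H))
          + C ^ 2 * (d * (K * ζ x) * (d * g)) + 1 * (C ^ 2 * (w x ^ 2 * (d ^ 2 * K)))) := by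
        gcongr
        norm_num
    _ = _ := by ring

end LocalEstimate

section CutoffEstimate

variable {d : ℕ}

local notation "𝔼" => EuclideanSpace ℝ (Fin d)

lemma weighted_sum_le {c a κ K M M' Γ U₀ U₁ U₂ F Y Z W V D ρ : ℝ} (hc : 0 < c) (ha : 0 < a)
    (hK : 0 < K) (hM : 0 ≤ M) (hM' : 0 ≤ M') (hκ : 0 < κ) (hρ : 1 ≤ ρ)
    (hκD : κ * D * (M + 2 * a * K) ≤ a / 16) (hΓ : 0 ≤ Γ) (hU₀ : 0 ≤ U₀) (hV : 0 ≤ V)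
    (hY : 0 ≤ Y) (hW : 0 ≤ W)
    (h₁ : ρ ^ 2 * U₀ + c * ρ * U₁ + a * U₂ ≤ F)
    (h₂ : F ≤ 5 * Γ + M * Z + a / 16 * Y + M' * W)
    (h₃ : Y ≤ 4 * U₂ + 8 * K * Z + 4 * K * W)
    (h₄ : V ≤ 2 * U₁ + 2 * K * W)
    (h₅ : Z ≤ κ * D * Y + (1 / κ + K) * W) :
    ρ ^ 2 * U₀ + ρ * V + Y ≤
      (5 + (M' + a * K + c * K + (M + 2 * a * K) * (1 / κ + K))) / min 1 (min (c / 2) (a / 8)) *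
        (Γ + ρ * W) := by
  have hm : 0 < min 1 (min (c / 2) (a / 8)) := by positivity
  have hm1 : min 1 (min (c / 2) (a / 8)) ≤ 1 := min_le_left _ _
  have hm2 : min 1 (min (c / 2) (a / 8)) ≤ c / 2 := (min_le_right _ _).trans (min_le_left _ _)
  have hm3 : min 1 (min (c / 2) (a / 8)) ≤ a / 8 := (min_le_right _ _).trans (min_le_right _ _)
  generalize min 1 (min (c / 2) (a / 8)) = m at *
  rw [div_mul_eq_mul_div, le_div_iff₀ hm]
  have hρ0 : 0 ≤ ρ := by linarith
  have g1 : c * ρ / 2 * V ≤ c * ρ / 2 * (2 * U₁ + 2 * K * W) := by gcongr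
  have g2 : a / 4 * Y ≤ a / 4 * (4 * U₂ + 8 * K * Z + 4 * K * W) := by gcongr
  have g3 : (M + 2 * a * K) * Z ≤ (M + 2 * a * K) * (κ * D * Y + (1 / κ + K) * W) := by gcongr
  have g4 : κ * D * (M + 2 * a * K) * Y ≤ a / 16 * Y := by gcongr
  have hWρ : W ≤ ρ * W := le_mul_of_one_le_left hW hρ
  have g5 : (M' + a * K + (M + 2 * a * K) * (1 / κ + K)) * W ≤
      (M' + a * K + (M + 2 * a * K) * (1 / κ + K)) * (ρ * W) := by gcongr
  have g6 : m * (ρ ^ 2 * U₀) ≤ 1 * (ρ ^ 2 * U₀) := by gcongr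
  have g7 : m * (ρ * V) ≤ c / 2 * (ρ * V) := by gcongr
  have g8 : m * Y ≤ a / 8 * Y := by gcongr
  have g9 : 0 ≤ (M' + a * K + c * K + (M + 2 * a * K) * (1 / κ + K)) * Γ := by positivity
  have g10 : 0 ≤ ρ * W := by positivity
  linarith

lemma cutoff_estimate (d : ℕ) {c C K δ : ℝ} (hc : 0 < c) (hK : 0 < K)
    (hδ : 5 * δ ^ 2 * d ^ 2 ≤ c ^ 2 / 64) :
    ∃ N : ℝ, 0 < N ∧ ∀ (ρ : ℝ) (s : Set (EuclideanSpace ℝ (Fin d)))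
      (ζ w G : EuclideanSpace ℝ (Fin d) → ℝ) (A : Fin d → Fin d → ℝ),
      1 ≤ ρ → Bornology.IsBounded s → MeasurableSet s → IsCutoff K s ζ → ContDiff ℝ 2 w →
      Continuous G → (∀ i j, A i j = A j i) → (∀ i j, |A i j| ≤ C) →
      (∀ ξ : Fin d → ℝ, c * ∑ i, ξ i ^ 2 ≤ ∑ i, ∑ j, ξ i * A i j * ξ j) →
      (∀ x ∈ s, |ρ * w x - 1 / 2 * ∑ i, ∑ j, A i j * pd2 d w x i j| ≤
        G x + C * (∑ i, |pd1 d w x i|) + δ * ∑ i, ∑ j, |pd2 d w x i j|) →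
      ρ ^ 2 * (∫ x in s, ζ x ^ 2 * w x ^ 2) + ρ * (∫ x in s, ζ x ^ 2 * gradSq w x) +
        (∫ x in s, ζ x ^ 2 * hessSq w x) ≤
          N * ((∫ x in s, G x ^ 2) + ρ * ∫ x in s, w x ^ 2) := by
  have ha : 0 < c ^ 2 / 4 := by positivity
  obtain ⟨M, hM⟩ : ∃ M : ℝ, M = 5 * C ^ 2 * (d + d ^ 2 * K) := ⟨_, rfl⟩
  obtain ⟨M', hM'⟩ : ∃ M' : ℝ, M' = 5 * C ^ 2 * d ^ 2 * K := ⟨_, rfl⟩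
  have hM0 : 0 ≤ M := hM ▸ by positivity
  have hM'0 : 0 ≤ M' := hM' ▸ by positivity
  obtain ⟨κ, hκ⟩ : ∃ κ : ℝ, κ = c ^ 2 / 4 / 16 / ((d + 1) * (M + 2 * (c ^ 2 / 4) * K)) := ⟨_, rfl⟩
  have hP : 0 < M + 2 * (c ^ 2 / 4) * K := by positivity
  have hκ0 : 0 < κ := hκ ▸ by positivity
  have hκD : κ * d * (M + 2 * (c ^ 2 / 4) * K) ≤ c ^ 2 / 4 / 16 := by
    rw [hκ, div_mul_eq_mul_div, div_mul_eq_mul_div, div_le_iff₀ (by positivity), mul_assoc]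
    gcongr
    linarith
  refine ⟨_, ?_, fun ρ s ζ w G A hρ hb hs hζ hw hG hA hAC hell hpde =>
    weighted_sum_le hc ha hK hM0 hM'0 hκ0 hρ hκD (U₁ := ∫ x in s, gradSq (fun y => ζ y * w y) x)
      (U₂ := ∫ x in s, hessSq (fun y => ζ y * w y) x) (Z := ∫ x in s, ζ x * gradSq w x)
      (F := ∫ x in s, (ρ * (ζ x * w x) -
        1 / 2 * ∑ i, ∑ j, A i j * pd2 d (fun y => ζ y * w y) x i j) ^ 2)
      ?_ ?_ ?_ ?_ ?_ ?_ ?_ ?_ ?_ ?_⟩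
  · positivity
  · exact integral_nonneg fun x => sq_nonneg _
  · exact integral_nonneg fun x => by positivity
  · exact integral_nonneg fun x => mul_nonneg (sq_nonneg _) (gradSq_nonneg w x)
  · exact integral_nonneg fun x => mul_nonneg (sq_nonneg _) (hessSq_nonneg w x)
  · exact integral_nonneg fun x => sq_nonneg _
  all_goals
    have hu : ContDiff ℝ 2 fun y => ζ y * w y := hζ.contDiff.mul hw
    have hu1 : ContDiff ℝ 1 fun y => ζ y * w y := hu.of_le (by norm_num)
    have hw1 : ContDiff ℝ 1 w := hw.of_le (by norm_num)
    have cz : Continuous ζ := hζ.contDiff.continuous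
    have cg := gradSq_continuous hw1
    have ch := hessSq_continuous hw
    have cw : Continuous fun x => w x ^ 2 := hw.continuous.pow 2
  · have hz : tsupport (fun y => ζ y * w y) ⊆ tsupport ζ := tsupport_mul_subset_left
    have h := constant_coefficient_estimate hu hζ.hasCompactSupport.mul_right hc.le
      (zero_le_one.trans hρ) hA hell
    rw [setIntegral_eq_integral_of_tsupport hζ.tsupport_subset,
      setIntegral_eq_integral_of_tsupport hζ.tsupport_subset,
      setIntegral_eq_integral_of_tsupport hζ.tsupport_subset,
      setIntegral_eq_integral_of_tsupport hζ.tsupport_subset]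
    · simpa only [mul_pow] using h
    · intro x hx
      simp [image_eq_zero_of_notMem_tsupport hx, pd2_eq_zero_of_notMem fun h => hx (hz h)]
    · exact fun x hx => hessSq_eq_zero_of_notMem fun h => hx (hz h)
    · exact fun x hx => gradSq_eq_zero_of_notMem fun h => hx (hz h)
    · intro x hx
      simp [image_eq_zero_of_notMem_tsupport hx]
  · have cf : Continuous fun x => (ρ * (ζ x * w x) -
        1 / 2 * ∑ i, ∑ j, A i j * pd2 d (fun y => ζ y * w y) x i j) ^ 2 :=
      ((continuous_const.mul hu.continuous).sub (continuous_const.mul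
        (continuous_finsetSum _ fun i _ => continuous_finsetSum _ fun j _ =>
          continuous_const.mul (pd2_continuous hu i j)))).pow 2
    refine setIntegral_le_combination hb hs cf (hG.pow 2) (cz.mul cg) ((cz.pow 2).mul ch) cw
      _ _ _ _ fun x hx => (sq_commutator_le hK hw hζ x hAC (hpde x hx)).trans ?_
    rw [← hM, ← hM']
    have : 5 * δ ^ 2 * d ^ 2 * (ζ x ^ 2 * hessSq w x) ≤
        c ^ 2 / 4 / 16 * (ζ x ^ 2 * hessSq w x) :=
      mul_le_mul_of_nonneg_right (hδ.trans (by linarith))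
        (mul_nonneg (sq_nonneg _) (hessSq_nonneg w x))
    simp only [Pi.mul_apply, Pi.pow_apply]
    linarith
  · exact setIntegral_le_combination₃ hb hs ((cz.pow 2).mul ch) (hessSq_continuous hu)
      (cz.mul cg) cw _ _ _ fun x _ => hessSq_mul_le hw hζ x
  · have h := setIntegral_le_combination₃ hb hs ((cz.pow 2).mul cg) (gradSq_continuous hu1)
      cw continuous_zero 2 (2 * K) 0 fun x _ => by
        simpa using gradSq_mul_le hw hζ x hK
    simpa using h
  · exact interpolation hK hκ0 hb hs hw hζ

end CutoffEstimate

section UniformEstimate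

variable {d : ℕ}

local notation "𝔼" => EuclideanSpace ℝ (Fin d)

lemma pd1_translate (w : 𝔼 → ℝ) (a x : 𝔼) (i : Fin d) :
    pd1 d (fun y => w (y - a)) x i = pd1 d w (x - a) i := by
  rw [pd1, fderiv_comp_sub, pd1]

lemma pd2_translate (w : 𝔼 → ℝ) (a x : 𝔼) (i j : Fin d) :
    pd2 d (fun y => w (y - a)) x i j = pd2 d w (x - a) i j := by
  simp only [pd2_eq_pd1, pd1_translate]
  exact pd1_translate (fun y => pd1 d w y j) a x i

lemma exists_forall_le_of_hasCompactSupport {f : 𝔼 → ℝ} (hf : Continuous f)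
    (hs : HasCompactSupport f) : ∃ C : ℝ, 0 ≤ C ∧ ∀ x, f x ≤ C := by
  obtain ⟨C, hC⟩ := hs.exists_bound_of_continuous hf
  exact ⟨C, (norm_nonneg _).trans (hC 0), fun x => (le_abs_self _).trans (hC x)⟩

lemma exists_isCutoff (d : ℕ) {R : ℝ} (hR : 0 < R) :
    ∃ K : ℝ, 0 < K ∧ ∀ x₀ : EuclideanSpace ℝ (Fin d),
      ∃ ζ, IsCutoff K (ball x₀ (2 * R)) ζ ∧ ∀ x ∈ ball x₀ R, ζ x = 1 := by
  obtain ⟨ψ, h1, h2⟩ : ∃ ψ : ContDiffBump (0 : EuclideanSpace ℝ (Fin d)),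
      ψ.rIn = R ∧ ψ.rOut = 3 / 2 * R :=
    ⟨⟨R, 3 / 2 * R, hR, by linarith⟩, rfl, rfl⟩
  have hψ : ContDiff ℝ 2 ψ := ψ.contDiff
  have hψ1 : ContDiff ℝ 1 ψ := ψ.contDiff
  have hζ : ContDiff ℝ 2 fun x => ψ x * ψ x := hψ.mul hψ
  have hζs : HasCompactSupport fun x => ψ x * ψ x := ψ.hasCompactSupport.mul_right
  obtain ⟨k₁, hk₁, hg⟩ := exists_forall_le_of_hasCompactSupport (gradSq_continuous hψ1)
    (gradSq_hasCompactSupport ψ.hasCompactSupport)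
  obtain ⟨k₂, hk₂, hh⟩ := exists_forall_le_of_hasCompactSupport (hessSq_continuous hζ)
    (hessSq_hasCompactSupport hζs)
  refine ⟨4 * k₁ + k₂ + 1, by positivity, fun x₀ => ⟨fun x => ψ (x - x₀) * ψ (x - x₀), ?_, ?_⟩⟩
  · have hts : tsupport (fun x => ψ (x - x₀) * ψ (x - x₀)) ⊆ closedBall x₀ (3 / 2 * R) := by
      refine closure_minimal (fun x hx => ?_) isClosed_closedBall
      by_contra hn
      rw [mem_closedBall, not_le, dist_eq_norm] at hn
      exact hx (by simp [ψ.zero_of_le_dist (x := x - x₀) (by simpa [h2] using hn.le)])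
    refine ⟨hζ.comp (contDiff_id.sub contDiff_const),
      HasCompactSupport.of_support_subset_isCompact (isCompact_closedBall x₀ (3 / 2 * R))
        ((subset_tsupport _).trans hts), fun x => mul_self_nonneg _,
      fun x => mul_le_one₀ ψ.le_one ψ.nonneg ψ.le_one, fun x => ?_, fun x => ?_,
      hts.trans (closedBall_subset_ball (by linarith))⟩
    · have e : gradSq (fun x => ψ (x - x₀) * ψ (x - x₀)) x =
          4 * (ψ (x - x₀) * ψ (x - x₀)) * gradSq ψ (x - x₀) := by
        simp only [gradSq, Finset.mul_sum]
        refine Finset.sum_congr rfl fun i _ => ?_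
        rw [pd1_translate (fun y => ψ y * ψ y), pd1_mul (hψ.differentiable (by norm_num) _)
          (hψ.differentiable (by norm_num) _)]
        ring
      have h0 : 0 ≤ ψ (x - x₀) * ψ (x - x₀) := mul_self_nonneg _
      have := mul_le_mul_of_nonneg_left (hg (x - x₀)) h0
      rw [e]
      nlinarith
    · have e : hessSq (fun x => ψ (x - x₀) * ψ (x - x₀)) x =
          hessSq (fun y => ψ y * ψ y) (x - x₀) := by
        simp only [hessSq, pd2_translate (fun y => ψ y * ψ y)]
      rw [e]
      linarith [hh (x - x₀)]
  · intro x hx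
    have : ψ (x - x₀) = 1 := ψ.one_of_mem_closedBall (by
      rw [mem_closedBall, dist_zero_right, ← dist_eq_norm, h1]
      exact (mem_ball.1 hx).le)
    simp [this]

lemma setIntegral_le_sum_of_subset {ι : Type*} (t : Finset ι) {s : Set 𝔼} (u : ι → Set 𝔼)
    (hs : MeasurableSet s) (hu : ∀ i, MeasurableSet (u i)) (hsu : s ⊆ ⋃ i ∈ t, u i)
    {f : 𝔼 → ℝ} (hf : ∀ x, 0 ≤ f x) (hfs : IntegrableOn f s)
    (hfu : ∀ i, IntegrableOn f (u i)) : ∫ x in s, f x ≤ ∑ i ∈ t, ∫ x in u i, f x := by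
  simp only [← integral_indicator hs, ← integral_indicator (hu _)]
  rw [← integral_finsetSum _ fun i _ => (integrable_indicator_iff (hu i)).2 (hfu i)]
  refine integral_mono ((integrable_indicator_iff hs).2 hfs)
    (integrable_finsetSum _ fun i _ => (integrable_indicator_iff (hu i)).2 (hfu i)) fun x => ?_
  have hn : ∀ i ∈ t, 0 ≤ (u i).indicator f x := fun i _ => Set.indicator_nonneg (fun x _ => hf x) x
  by_cases hx : x ∈ s
  · obtain ⟨i, hi, hxi⟩ := Set.mem_iUnion₂.1 (hsu hx)
    rw [Set.indicator_of_mem hx]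
    refine le_trans ?_ (Finset.single_le_sum hn hi)
    rw [Set.indicator_of_mem hxi]
  · rw [Set.indicator_of_notMem hx]
    exact Finset.sum_nonneg hn

lemma exists_ball_covering_bound (d : ℕ) {R : ℝ} (hR : 0 < R) (r : ℝ) :
    ∃ N : ℝ, 1 ≤ N ∧ ∀ (f : EuclideanSpace ℝ (Fin d) → ℝ) (L : ℝ), Continuous f → (∀ x, 0 ≤ f x) →
      (∀ y, ∫ x in ball y R, f x ≤ L) → ∀ y, ∫ x in ball y r, f x ≤ N * L := by
  obtain ⟨t, -, ht, htc⟩ := finite_cover_balls_of_compact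
    (isCompact_closedBall (0 : EuclideanSpace ℝ (Fin d)) r) hR
  refine ⟨ht.toFinset.card + 1, by simp, fun f L hf hf0 hL y => ?_⟩
  have hL0 : 0 ≤ L := (integral_nonneg hf0).trans (hL 0)
  have h := setIntegral_le_sum_of_subset ht.toFinset (s := ball y r) (fun z => ball (y + z) R)
    measurableSet_ball (fun _ => measurableSet_ball) (fun x hx => ?_) hf0
    (integrableOn_of_isBounded isBounded_ball hf)
    (fun _ => integrableOn_of_isBounded isBounded_ball hf)
  · refine h.trans ((Finset.sum_le_card_nsmul _ _ L fun z _ => hL (y + z)).trans ?_)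
    rw [nsmul_eq_mul]
    linarith
  · have hx' : x - y ∈ closedBall (0 : EuclideanSpace ℝ (Fin d)) r := by
      rw [mem_closedBall, dist_zero_right, ← dist_eq_norm]
      exact (mem_ball.1 hx).le
    obtain ⟨z, hz, hxz⟩ := Set.mem_iUnion₂.1 (htc hx')
    refine Set.mem_iUnion₂.2 ⟨z, ht.mem_toFinset.2 hz, ?_⟩
    rw [mem_ball, dist_eq_norm] at hxz ⊢
    rwa [← sub_sub]

lemma setIntegral_ball_le_of_le {f : 𝔼 → ℝ} {M : ℝ} (hf : Continuous f) (hM : ∀ x, f x ≤ M)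
    (y : 𝔼) (R : ℝ) : ∫ x in ball y R, f x ≤ M * volume.real (ball (0 : 𝔼) R) := by
  have h := setIntegral_mono_on (integrableOn_of_isBounded isBounded_ball hf)
    (integrableOn_of_isBounded isBounded_ball (continuous_const (y := M))) measurableSet_ball
    fun x (_ : x ∈ ball y R) => hM x
  refine h.trans (le_of_eq ?_)
  rw [setIntegral_const, smul_eq_mul, mul_comm, measureReal_def, measureReal_def,
    Measure.addHaar_ball_center]

lemma uniform_local_estimate (d : ℕ) {c C δ R : ℝ} (hc : 0 < c) (hR : 0 < R)
    (hδ : 5 * δ ^ 2 * d ^ 2 ≤ c ^ 2 / 64) :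
    ∃ N : ℝ, 1 ≤ N ∧ ∀ (ρ Γ M : ℝ) (w G : EuclideanSpace ℝ (Fin d) → ℝ),
      N ≤ ρ → ContDiff ℝ 2 w → (∀ x, |w x| ≤ M) → Continuous G →
      (∀ x₀, ∫ x in ball x₀ R, G x ^ 2 ≤ Γ) →
      (∀ x₀, ∃ A : Fin d → Fin d → ℝ, (∀ i j, A i j = A j i) ∧ (∀ i j, |A i j| ≤ C) ∧
        (∀ ξ : Fin d → ℝ, c * ∑ i, ξ i ^ 2 ≤ ∑ i, ∑ j, ξ i * A i j * ξ j) ∧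
        ∀ x ∈ ball x₀ (2 * R), |ρ * w x - 1 / 2 * ∑ i, ∑ j, A i j * pd2 d w x i j| ≤
          G x + C * (∑ i, |pd1 d w x i|) + δ * ∑ i, ∑ j, |pd2 d w x i j|) →
      ∀ x₀, ρ ^ 2 * (∫ x in ball x₀ R, w x ^ 2) + ρ * (∫ x in ball x₀ R, gradSq w x) +
        (∫ x in ball x₀ R, hessSq w x) ≤ N * Γ := by
  obtain ⟨K, hK, hcut⟩ := exists_isCutoff d hR
  obtain ⟨N₀, hN₀, hest⟩ := cutoff_estimate d (C := C) hc hK hδ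
  obtain ⟨N₁, hN₁, hcov⟩ := exists_ball_covering_bound d hR (2 * R)
  have hP : 0 < N₀ * N₁ := by positivity
  refine ⟨2 * (N₀ * N₁) + 1, by linarith, fun ρ Γ M w G hρ hw hM hG hΓ hA => ?_⟩
  have hρ1 : 1 ≤ ρ := by linarith
  have hρ0 : 0 < ρ := by linarith
  have cw : Continuous fun x => w x ^ 2 := hw.continuous.pow 2
  have cg := gradSq_continuous (hw.of_le (by norm_num) : ContDiff ℝ 1 w)
  have ch := hessSq_continuous hw
  have hΓ0 : 0 ≤ Γ := (integral_nonneg fun x => sq_nonneg (G x)).trans (hΓ 0)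
  have hbdd : BddAbove (Set.range fun y => ∫ x in ball y R, w x ^ 2) := by
    refine ⟨M ^ 2 * volume.real (ball (0 : EuclideanSpace ℝ (Fin d)) R), ?_⟩
    rintro _ ⟨y, rfl⟩
    exact setIntegral_ball_le_of_le cw (fun x => sq_le_sq.2 ((hM x).trans (le_abs_self M))) y R
  obtain ⟨L, hL⟩ : ∃ L, L = ⨆ y, ∫ x in ball y R, w x ^ 2 := ⟨_, rfl⟩
  have hwL : ∀ y, ∫ x in ball y R, w x ^ 2 ≤ L := fun y => hL ▸ le_ciSup hbdd y
  have key : ∀ x₀, ρ ^ 2 * (∫ x in ball x₀ R, w x ^ 2) + ρ * (∫ x in ball x₀ R, gradSq w x) +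
        (∫ x in ball x₀ R, hessSq w x) ≤ N₀ * (N₁ * Γ + ρ * (N₁ * L)) := by
    intro x₀
    obtain ⟨ζ, hζ, hζ1⟩ := hcut x₀
    obtain ⟨A, hAs, hAC, hell, hpde⟩ := hA x₀
    have h := hest ρ _ ζ w G A hρ1 isBounded_ball measurableSet_ball hζ hw hG hAs hAC hell hpde
    have hG2 := hcov (fun x => G x ^ 2) Γ (hG.pow 2) (fun x => sq_nonneg _) hΓ x₀
    have hw2 := hcov _ L cw (fun x => sq_nonneg _) hwL x₀
    have hmono : ∀ f : EuclideanSpace ℝ (Fin d) → ℝ, Continuous f → (∀ x, 0 ≤ f x) →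
        ∫ x in ball x₀ R, f x ≤ ∫ x in ball x₀ (2 * R), ζ x ^ 2 * f x := by
      intro f hf hf0
      have e : ∫ x in ball x₀ R, f x = ∫ x in ball x₀ R, ζ x ^ 2 * f x :=
        setIntegral_congr_fun measurableSet_ball fun x hx => by simp [hζ1 x hx]
      rw [e]
      exact setIntegral_mono_set (integrableOn_of_isBounded isBounded_ball
        ((hζ.contDiff.continuous.pow 2).mul hf))
        (Filter.Eventually.of_forall fun x => mul_nonneg (sq_nonneg _) (hf0 x))
        (ball_subset_ball (by linarith)).eventuallyLE
    have m1 := hmono _ cw fun x => sq_nonneg _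
    have m2 := hmono _ cg (gradSq_nonneg w)
    have m3 := hmono _ ch (hessSq_nonneg w)
    calc _ ≤ _ := by gcongr
      _ ≤ _ := h
      _ ≤ _ := by gcongr
  have hg0 : ∀ x₀, 0 ≤ ∫ x in ball x₀ R, gradSq w x := fun x₀ => integral_nonneg (gradSq_nonneg w)
  have hh0 : ∀ x₀, 0 ≤ ∫ x in ball x₀ R, hessSq w x := fun x₀ => integral_nonneg (hessSq_nonneg w)
  have hL2 : ρ ^ 2 * L ≤ N₀ * (N₁ * Γ + ρ * (N₁ * L)) := by
    rw [mul_comm, ← le_div_iff₀ (by positivity), hL]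
    refine ciSup_le fun y => ?_
    rw [← hL, le_div_iff₀ (by positivity), mul_comm]
    have := key y
    have := mul_nonneg hρ0.le (hg0 y)
    linarith [hh0 y]
  have hL0 : 0 ≤ L := (integral_nonneg fun x => sq_nonneg (w x)).trans (hwL 0)
  have hab : 2 * (N₀ * N₁) * (ρ * L) ≤ ρ * (ρ * L) :=
    mul_le_mul_of_nonneg_right (by linarith) (by positivity)
  intro x₀
  refine (key x₀).trans ?_
  nlinarith

end UniformEstimate

section Gibbs

variable {Ω : Type*} [MeasurableSpace Ω] {μ : Measure Ω}

lemma integrable_mul_of_abs_le {f g : Ω → ℝ} {C : ℝ} (hf : Measurable f)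
    (hC : ∀ᵐ u ∂μ, |f u| ≤ C) (hg : Integrable g μ) : Integrable (fun u => f u * g u) μ :=
  hg.bdd_mul hf.aestronglyMeasurable hC

lemma integrable_exp_of_abs_le [IsFiniteMeasure μ] {p : Ω → ℝ} {C : ℝ} (hp : Measurable p)
    (hC : ∀ᵐ u ∂μ, |p u| ≤ C) : Integrable (fun u => exp (p u)) μ := by
  refine Integrable.of_bound hp.exp.aestronglyMeasurable (exp C) ?_
  filter_upwards [hC] with u hu
  rw [norm_eq_abs, abs_exp]
  exact exp_le_exp.2 ((le_abs_self _).trans hu)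

lemma abs_integral_mul_density_sub_le {f g : Ω → ℝ} {c H : ℝ} (hg : Integrable g μ)
    (hg0 : ∀ u, 0 ≤ g u) (hg1 : ∫ u, g u ∂μ = 1) (hf : Measurable f)
    (hH : ∀ᵐ u ∂μ, |f u - c| ≤ H) : |(∫ u, f u * g u ∂μ) - c| ≤ H := by
  have hi : Integrable (fun u => (f u - c) * g u) μ :=
    integrable_mul_of_abs_le (hf.sub_const c) hH hg
  have e : (∫ u, f u * g u ∂μ) - c = ∫ u, (f u - c) * g u ∂μ := by
    have h : (fun u => f u * g u) = fun u => (f u - c) * g u + c * g u := by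
      ext u
      ring
    rw [h, integral_add hi (hg.const_mul c), integral_const_mul, hg1]
    ring
  rw [e, ← norm_eq_abs]
  refine (norm_integral_le_of_norm_le (hg.const_mul H) ?_).trans (le_of_eq ?_)
  · filter_upwards [hH] with u hu
    rw [norm_mul, norm_eq_abs, norm_of_nonneg (hg0 u)]
    exact mul_le_mul_of_nonneg_right hu (hg0 u)
  · rw [integral_const_mul, hg1, mul_one]

lemma abs_log_integral_exp_sub_le [IsProbabilityMeasure μ] {p q : Ω → ℝ} {c H : ℝ}
    (hp : Integrable (fun u => exp (p u)) μ) (hq : Integrable (fun u => exp (q u)) μ)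
    (h : ∀ᵐ u ∂μ, |q u - p u - c| ≤ H) :
    |log (∫ u, exp (q u) ∂μ) - log (∫ u, exp (p u) ∂μ) - c| ≤ H := by
  have key : ∀ (p q : Ω → ℝ) (a : ℝ), Integrable (fun u => exp (p u)) μ →
      Integrable (fun u => exp (q u)) μ → (∀ᵐ u ∂μ, q u ≤ p u + a) →
      log (∫ u, exp (q u) ∂μ) ≤ log (∫ u, exp (p u) ∂μ) + a := by
    intro p q a hp hq h
    have hP := integral_exp_pos hp
    have hQ := integral_exp_pos hq
    rw [← log_exp a, ← log_mul hP.ne' (exp_pos a).ne', ← integral_mul_const]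
    refine log_le_log hQ (integral_mono_ae hq (hp.mul_const _) ?_)
    filter_upwards [h] with u hu
    rw [← exp_add]
    exact exp_le_exp.2 hu
  have h1 := key p q (c + H) hp hq (by
    filter_upwards [h] with u hu
    linarith [(abs_le.1 hu).2])
  have h2 := key q p (H - c) hq hp (by
    filter_upwards [h] with u hu
    linarith [(abs_le.1 hu).1])
  exact abs_le.2 ⟨by linarith, by linarith⟩

/-- The free energy `log ∫ e^q` differs from its linearization at `p` by at most twice the
oscillation bound of `q - p`. -/
lemma abs_log_integral_exp_sub_linearization_le [IsProbabilityMeasure μ] {p q : Ω → ℝ}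
    {c H C : ℝ} (hp : Measurable p) (hq : Measurable q) (hpC : ∀ᵐ u ∂μ, |p u| ≤ C)
    (hqC : ∀ᵐ u ∂μ, |q u| ≤ C) (h : ∀ᵐ u ∂μ, |q u - p u - c| ≤ H) {g : Ω → ℝ}
    (hg : g = fun u => exp (p u) / ∫ u', exp (p u') ∂μ) :
    |log (∫ u, exp (q u) ∂μ) - (∫ u, q u * g u ∂μ) + ∫ u, log (g u) * g u ∂μ| ≤ 2 * H := by
  have ip := integrable_exp_of_abs_le hp hpC
  have iq := integrable_exp_of_abs_le hq hqC
  have hP := integral_exp_pos ip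
  have hgi : Integrable g μ := hg ▸ ip.div_const _
  have hg0 : ∀ u, 0 ≤ g u := fun u => hg ▸ (by positivity)
  have hg1 : ∫ u, g u ∂μ = 1 := by
    rw [hg, integral_div, div_self hP.ne']
  have h1 := abs_log_integral_exp_sub_le ip iq h
  have h2 := abs_integral_mul_density_sub_le hgi hg0 hg1 (hq.sub hp) h
  have igp := integrable_mul_of_abs_le hp hpC hgi
  have igq := integrable_mul_of_abs_le hq hqC hgi
  have e1 : ∫ u, (q - p) u * g u ∂μ = (∫ u, q u * g u ∂μ) - ∫ u, p u * g u ∂μ := by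
    simp only [Pi.sub_apply, sub_mul]
    exact integral_sub igq igp
  have e2 : ∫ u, log (g u) * g u ∂μ = (∫ u, p u * g u ∂μ) - log (∫ u, exp (p u) ∂μ) := by
    have : (fun u => log (g u) * g u) =
        fun u => p u * g u - log (∫ u, exp (p u) ∂μ) * g u := by
      ext u
      have : log (g u) = p u - log (∫ u, exp (p u) ∂μ) := by
        rw [hg, log_div (exp_pos _).ne' hP.ne', log_exp]
      rw [this]
      ring
    rw [this, integral_sub igp (hgi.const_mul _), integral_const_mul, hg1, mul_one]
  rw [e1] at h2
  rw [e2]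
  rw [abs_le] at h1 h2 ⊢
  constructor <;> linarith

lemma integral_affine_mul {d : ℕ} {r g : Ω → ℝ} {b : Ω → Fin d → ℝ}
    {S : Ω → Matrix (Fin d) (Fin d) ℝ} (hr : Integrable (fun u => r u * g u) μ)
    (hb : ∀ i, Integrable (fun u => b u i * g u) μ)
    (hS : ∀ i j, Integrable (fun u => S u i j * g u) μ) (p : Fin d → ℝ)
    (X : Matrix (Fin d) (Fin d) ℝ) :
    ∫ u, (r u + ∑ i, b u i * p i + 1 / 2 * ∑ i, ∑ j, S u i j * X j i) * g u ∂μ =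
      (∫ u, r u * g u ∂μ) + (∑ i, (∫ u, b u i * g u ∂μ) * p i) +
        1 / 2 * ∑ i, ∑ j, (∫ u, S u i j * g u ∂μ) * X j i := by
  have e : (fun u => (r u + ∑ i, b u i * p i + 1 / 2 * ∑ i, ∑ j, S u i j * X j i) * g u) =
      fun u => (r u * g u + ∑ i, (b u i * g u) * p i) +
        1 / 2 * ∑ i, ∑ j, (S u i j * g u) * X j i := by
    ext u
    simp only [add_mul, Finset.sum_mul, Finset.mul_sum]
    congr 1
    · congr 1
      exact Finset.sum_congr rfl fun i _ => by ring
    · exact Finset.sum_congr rfl fun i _ => Finset.sum_congr rfl fun j _ => by ring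
  have ib : Integrable (fun u => ∑ i, (b u i * g u) * p i) μ :=
    integrable_finsetSum _ fun i _ => (hb i).mul_const _
  have iS : Integrable (fun u => ∑ i, ∑ j, (S u i j * g u) * X j i) μ :=
    integrable_finsetSum _ fun i _ => integrable_finsetSum _ fun j _ => (hS i j).mul_const _
  have i1 : Integrable (fun u => r u * g u + ∑ i, (b u i * g u) * p i) μ := hr.add ib
  rw [e, integral_add i1 (iS.const_mul _), integral_add hr ib, integral_const_mul,
    integral_finsetSum _ fun i _ => (hb i).mul_const _,
    integral_finsetSum _ fun i _ => integrable_finsetSum _ fun j _ => (hS i j).mul_const _]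
  simp only [integral_mul_const]
  congr 2
  refine Finset.sum_congr rfl fun i _ => ?_
  rw [integral_finsetSum _ fun j _ => (hS i j).mul_const _]
  simp only [integral_mul_const]

end Gibbs

section PolicyStep

variable {d l : ℕ} {lam C₀ ε₀ ρ : ℝ} {U : Set (EuclideanSpace ℝ (Fin l))}
  {r : EuclideanSpace ℝ (Fin d) → EuclideanSpace ℝ (Fin l) → ℝ}
  {b : EuclideanSpace ℝ (Fin d) → EuclideanSpace ℝ (Fin l) → Fin d → ℝ}
  {S : EuclideanSpace ℝ (Fin d) → EuclideanSpace ℝ (Fin l) → Matrix (Fin d) (Fin d) ℝ}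
  {S0 : EuclideanSpace ℝ (Fin d) → Matrix (Fin d) (Fin d) ℝ}

local notation "𝔼" => EuclideanSpace ℝ (Fin d)

lemma abs_sum_mul_le {ι : Type*} {s : Finset ι} {a : ι → ℝ} {C : ℝ} (ha : ∀ i, |a i| ≤ C)
    (f : ι → ℝ) : |∑ i ∈ s, a i * f i| ≤ C * ∑ i ∈ s, |f i| := by
  rw [Finset.mul_sum]
  refine (Finset.abs_sum_le_sum_abs _ _).trans (Finset.sum_le_sum fun i _ => ?_)
  rw [abs_mul]
  exact mul_le_mul_of_nonneg_right (ha i) (abs_nonneg _)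

lemma measurable_gibbsExponent {x : 𝔼} (hr : Measurable fun u => r x u)
    (hb : ∀ i, Measurable fun u => b x u i) (hS : ∀ i j, Measurable fun u => S x u i j)
    (p : Fin d → ℝ) (X : Matrix (Fin d) (Fin d) ℝ) :
    Measurable (gibbsExponent d l lam r b S x p X) :=
  ((hr.add (Finset.measurable_fun_sum _ fun i _ => (hb i).mul_const _)).add
    ((Finset.measurable_fun_sum _ fun i _ => Finset.measurable_fun_sum _ fun j _ =>
      (hS i j).mul_const _).const_mul _)).const_mul _

lemma abs_gibbsExponent_le (hlam : 0 < lam) {x : 𝔼} {u : EuclideanSpace ℝ (Fin l)}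
    (hr : |r x u| ≤ C₀) (hb : ∀ i, |b x u i| ≤ C₀) (hS : ∀ i j, |S x u i j| ≤ C₀)
    (p : Fin d → ℝ) (X : Matrix (Fin d) (Fin d) ℝ) :
    |gibbsExponent d l lam r b S x p X u| ≤
      1 / lam * (C₀ + C₀ * (∑ i, |p i|) + 1 / 2 * (C₀ * ∑ i, ∑ j, |X j i|)) := by
  have h1 := abs_sum_mul_le (s := Finset.univ) hb p
  have h2 := abs_contraction_le hS fun i j => X j i
  have h3 : |r x u + ∑ i, b x u i * p i + 1 / 2 * ∑ i, ∑ j, S x u i j * X j i| ≤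
      C₀ + C₀ * (∑ i, |p i|) + 1 / 2 * (C₀ * ∑ i, ∑ j, |X j i|) := by
    rw [abs_le] at hr h1 h2 ⊢
    constructor <;> linarith
  rw [gibbsExponent, abs_mul, abs_of_pos (one_div_pos.2 hlam)]
  exact mul_le_mul_of_nonneg_left h3 (one_div_pos.2 hlam).le

lemma abs_gibbsExponent_sub_sub_le (hlam : 0 < lam) {x : 𝔼} {u : EuclideanSpace ℝ (Fin l)}
    (hb : ∀ i, |b x u i| ≤ C₀) (hS : ∀ i j, |S x u i j - S0 x i j| ≤ ε₀)
    (p q : Fin d → ℝ) (X Y : Matrix (Fin d) (Fin d) ℝ) :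
    |gibbsExponent d l lam r b S x q Y u - gibbsExponent d l lam r b S x p X u -
        1 / lam * (1 / 2 * ∑ i, ∑ j, S0 x i j * (Y j i - X j i))| ≤
      1 / lam * (C₀ * (∑ i, |q i - p i|) + 1 / 2 * (ε₀ * ∑ i, ∑ j, |Y j i - X j i|)) := by
  have h1 := abs_sum_mul_le (s := Finset.univ) hb fun i => q i - p i
  have h2 := abs_contraction_le hS fun i j => Y j i - X j i
  have e : gibbsExponent d l lam r b S x q Y u - gibbsExponent d l lam r b S x p X u -
        1 / lam * (1 / 2 * ∑ i, ∑ j, S0 x i j * (Y j i - X j i)) =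
      1 / lam * ((∑ i, b x u i * (q i - p i)) +
        1 / 2 * ∑ i, ∑ j, (S x u i j - S0 x i j) * (Y j i - X j i)) := by
    simp only [gibbsExponent, mul_sub, sub_mul, Finset.sum_sub_distrib]
    ring
  rw [e, abs_mul, abs_of_pos (one_div_pos.2 hlam)]
  refine mul_le_mul_of_nonneg_left ?_ (one_div_pos.2 hlam).le
  rw [abs_le] at h1 h2 ⊢
  constructor <;> linarith

/-- One step of policy iteration at a fixed point `x`: the error solves the linearized equation
up to a remainder controlled by the derivatives of the previous error. -/
lemma abs_policy_step_le [IsProbabilityMeasure (volume.restrict U)] (hU : MeasurableSet U)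
    (hlam : 0 < lam) {x : 𝔼} (hrm : Measurable fun u => r x u)
    (hbm : ∀ i, Measurable fun u => b x u i) (hSm : ∀ i j, Measurable fun u => S x u i j)
    (hr : ∀ u ∈ U, |r x u| ≤ C₀) (hb : ∀ u ∈ U, ∀ i, |b x u i| ≤ C₀)
    (hS : ∀ u ∈ U, ∀ i j, |S x u i j| ≤ C₀)
    (hS0 : ∀ u ∈ U, ∀ i j, |S x u i j - S0 x i j| ≤ ε₀) {y z : ℝ} (p q t : Fin d → ℝ)
    (X Y T : Matrix (Fin d) (Fin d) ℝ) {g : EuclideanSpace ℝ (Fin l) → ℝ}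
    (hg : g = gibbsDensity d l lam U r b S x p X)
    (hz : ρ * z = expF d l lam U r b S x q Y)
    (hy : ρ * y - (∫ u in U, r x u * g u) - (∑ i, (∫ u in U, b x u i * g u) * t i) -
      1 / 2 * (∑ i, ∑ j, (∫ u in U, S x u i j * g u) * T j i) +
      lam * (∫ u in U, log (g u) * g u) = 0) :
    |ρ * (y - z) - (∑ i, (∫ u in U, b x u i * g u) * (t i - q i)) -
        1 / 2 * ∑ i, ∑ j, (∫ u in U, S x u i j * g u) * (T j i - Y j i)| ≤
      2 * C₀ * (∑ i, |q i - p i|) + ε₀ * ∑ i, ∑ j, |Y j i - X j i| := by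
  have ae : ∀ {P : EuclideanSpace ℝ (Fin l) → Prop}, (∀ u ∈ U, P u) →
      ∀ᵐ u ∂volume.restrict U, P u := fun h =>
    (ae_restrict_iff' hU).2 (Filter.Eventually.of_forall h)
  have hpm := measurable_gibbsExponent (lam := lam) hrm hbm hSm p X
  have hqm := measurable_gibbsExponent (lam := lam) hrm hbm hSm q Y
  have hpC := fun u hu => abs_gibbsExponent_le hlam (hr u hu) (hb u hu) (hS u hu) p X
  have hqC := fun u hu => abs_gibbsExponent_le hlam (hr u hu) (hb u hu) (hS u hu) q Y
  have hgap := abs_log_integral_exp_sub_linearization_le hpm hqm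
    (ae fun u hu => (hpC u hu).trans (le_max_left _ _))
    (ae fun u hu => (hqC u hu).trans (le_max_right _ _))
    (ae fun u hu => abs_gibbsExponent_sub_sub_le hlam (hb u hu) (hS0 u hu) p q X Y) hg
  have hgi : Integrable g (volume.restrict U) := by
    rw [hg]
    exact (integrable_exp_of_abs_le hpm (ae hpC)).div_const _
  have haff := integral_affine_mul (integrable_mul_of_abs_le hrm (ae hr) hgi)
    (fun i => integrable_mul_of_abs_le (hbm i) (ae fun u hu => hb u hu i) hgi)
    (fun i j => integrable_mul_of_abs_le (hSm i j) (ae fun u hu => hS u hu i j) hgi) q Y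
  have hlin : lam * ∫ u in U, gibbsExponent d l lam r b S x q Y u * g u =
      ∫ u in U, (r x u + ∑ i, b x u i * q i + 1 / 2 * ∑ i, ∑ j, S x u i j * Y j i) * g u := by
    rw [← integral_const_mul]
    congr 1
    ext u
    rw [gibbsExponent]
    field_simp
  rw [haff] at hlin
  rw [expF] at hz
  have e : ρ * (y - z) - (∑ i, (∫ u in U, b x u i * g u) * (t i - q i)) -
        1 / 2 * ∑ i, ∑ j, (∫ u in U, S x u i j * g u) * (T j i - Y j i) =
      -(lam * (log (∫ u in U, exp (gibbsExponent d l lam r b S x q Y u)) -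
        (∫ u in U, gibbsExponent d l lam r b S x q Y u * g u) +
        ∫ u in U, log (g u) * g u)) := by
    simp only [mul_sub, Finset.sum_sub_distrib, mul_add]
    linarith
  rw [e, abs_neg, abs_mul, abs_of_pos hlam]
  refine (mul_le_mul_of_nonneg_left hgap hlam.le).trans (le_of_eq ?_)
  field_simp

lemma abs_freeze_le {C D G L : ℝ} {β f : Fin d → ℝ} {a M h : Fin d → Fin d → ℝ}
    (hβ : ∀ i, |β i| ≤ C) (ha : ∀ i j, |a i j - M i j| ≤ D) (hh : ∀ i j, h i j = h j i)
    (hL : |L - (∑ i, β i * f i) - 1 / 2 * ∑ i, ∑ j, a i j * h j i| ≤ G) :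
    |L - 1 / 2 * ∑ i, ∑ j, (M i j + M j i) / 2 * h i j| ≤
      G + C * (∑ i, |f i|) + D / 2 * ∑ i, ∑ j, |h i j| := by
  have h1 := abs_sum_mul_le (s := Finset.univ) hβ f
  have h2 := abs_contraction_le ha h
  have e1 : ∑ i, ∑ j, (M i j + M j i) / 2 * h i j = ∑ i, ∑ j, M i j * h i j := by
    have e : ∑ i, ∑ j, M j i * h i j = ∑ i, ∑ j, M i j * h i j := by
      rw [Finset.sum_comm]
      exact Finset.sum_congr rfl fun i _ => Finset.sum_congr rfl fun j _ => by rw [hh]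
    have e' : ∑ i, ∑ j, (M i j + M j i) / 2 * h i j =
        1 / 2 * ((∑ i, ∑ j, M i j * h i j) + ∑ i, ∑ j, M j i * h i j) := by
      simp only [← Finset.sum_add_distrib, Finset.mul_sum]
      exact Finset.sum_congr rfl fun i _ => Finset.sum_congr rfl fun j _ => by ring
    rw [e', e]
    ring
  have e2 : ∑ i, ∑ j, a i j * h j i = ∑ i, ∑ j, a i j * h i j :=
    Finset.sum_congr rfl fun i _ => Finset.sum_congr rfl fun j _ => by rw [hh]
  simp only [sub_mul, Finset.sum_sub_distrib] at h2
  rw [e1]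
  rw [e2] at hL
  rw [abs_le] at h1 h2 hL ⊢
  constructor <;> linarith

lemma symmetrization_elliptic {M : Fin d → Fin d → ℝ} {c : ℝ}
    (h : ∀ ξ : Fin d → ℝ, c * ∑ i, ξ i ^ 2 ≤ ∑ i, ∑ j, ξ i * M i j * ξ j) (ξ : Fin d → ℝ) :
    c * ∑ i, ξ i ^ 2 ≤ ∑ i, ∑ j, ξ i * ((M i j + M j i) / 2) * ξ j := by
  refine (h ξ).trans (le_of_eq ?_)
  have e : ∑ i, ∑ j, ξ i * M j i * ξ j = ∑ i, ∑ j, ξ i * M i j * ξ j := by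
    rw [Finset.sum_comm]
    exact Finset.sum_congr rfl fun i _ => Finset.sum_congr rfl fun j _ => by ring
  have e' : ∑ i, ∑ j, ξ i * ((M i j + M j i) / 2) * ξ j =
      1 / 2 * ((∑ i, ∑ j, ξ i * M i j * ξ j) + ∑ i, ∑ j, ξ i * M j i * ξ j) := by
    simp only [← Finset.sum_add_distrib, Finset.mul_sum]
    exact Finset.sum_congr rfl fun i _ => Finset.sum_congr rfl fun j _ => by ring
  rw [e', e]
  ring

end PolicyStep

section ErrorContraction

variable {d l : ℕ} {lam C₀ ε₀ ρ : ℝ} {U : Set (EuclideanSpace ℝ (Fin l))}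
  {r : EuclideanSpace ℝ (Fin d) → EuclideanSpace ℝ (Fin l) → ℝ}
  {b : EuclideanSpace ℝ (Fin d) → EuclideanSpace ℝ (Fin l) → Fin d → ℝ}
  {S : EuclideanSpace ℝ (Fin d) → EuclideanSpace ℝ (Fin l) → Matrix (Fin d) (Fin d) ℝ}
  {S0 : EuclideanSpace ℝ (Fin d) → Matrix (Fin d) (Fin d) ℝ}

local notation "𝔼" => EuclideanSpace ℝ (Fin d)

lemma sq_source_le (w : 𝔼 → ℝ) (x : 𝔼) :
    (2 * C₀ * (∑ i, |pd1 d w x i|) + ε₀ * ∑ i, ∑ j, |pd2 d w x i j|) ^ 2 ≤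
      8 * C₀ ^ 2 * d * gradSq w x + 2 * ε₀ ^ 2 * d ^ 2 * hessSq w x := by
  have h1 := mul_le_mul_of_nonneg_left (sq_sum_abs_pd1_le w x) (sq_nonneg C₀)
  have h2 := mul_le_mul_of_nonneg_left (sq_sum_abs_pd2_le w x) (sq_nonneg ε₀)
  nlinarith [sq_nonneg (2 * C₀ * (∑ i, |pd1 d w x i|) - ε₀ * ∑ i, ∑ j, |pd2 d w x i j|)]

lemma integrable_exp_gibbsExponent [IsFiniteMeasure (volume.restrict U)] (hU : MeasurableSet U)
    (hlam : 0 < lam) {x : 𝔼} (hrm : Measurable fun u => r x u)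
    (hbm : ∀ i, Measurable fun u => b x u i) (hSm : ∀ i j, Measurable fun u => S x u i j)
    (hr : ∀ u ∈ U, |r x u| ≤ C₀) (hb : ∀ u ∈ U, ∀ i, |b x u i| ≤ C₀)
    (hS : ∀ u ∈ U, ∀ i j, |S x u i j| ≤ C₀) (p : Fin d → ℝ) (X : Matrix (Fin d) (Fin d) ℝ) :
    Integrable (fun u => exp (gibbsExponent d l lam r b S x p X u)) (volume.restrict U) :=
  integrable_exp_of_abs_le (measurable_gibbsExponent hrm hbm hSm p X)
    ((ae_restrict_iff' hU).2 (Filter.Eventually.of_forall fun u hu =>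
      abs_gibbsExponent_le hlam (hr u hu) (hb u hu) (hS u hu) p X))

lemma abs_integral_mul_gibbsDensity_sub_le [IsProbabilityMeasure (volume.restrict U)]
    (hU : MeasurableSet U) {x : 𝔼} {p : Fin d → ℝ} {X : Matrix (Fin d) (Fin d) ℝ}
    (hi : Integrable (fun u => exp (gibbsExponent d l lam r b S x p X u)) (volume.restrict U))
    {f : EuclideanSpace ℝ (Fin l) → ℝ} (hf : Measurable f) {c H : ℝ}
    (h : ∀ u ∈ U, |f u - c| ≤ H) :
    |(∫ u in U, f u * gibbsDensity d l lam U r b S x p X u) - c| ≤ H := by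
  have hP := integral_exp_pos hi
  refine abs_integral_mul_density_sub_le (hi.div_const _) (fun u => ?_) ?_ hf
    ((ae_restrict_iff' hU).2 (Filter.Eventually.of_forall h))
  · exact div_nonneg (exp_pos _).le hP.le
  · simp only [gibbsDensity]
    rw [integral_div, div_self hP.ne']

lemma exists_frozen_coefficients {α R δ : ℝ} (hα : 0 < α) (hU : MeasurableSet U)
    (hvol : volume U = 1) (hlam : 0 < lam) (hC₀ : 0 ≤ C₀) (hrm : ∀ x, Measurable fun u => r x u)
    (hbm : ∀ x i, Measurable fun u => b x u i) (hSm : ∀ x i j, Measurable fun u => S x u i j)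
    (hell : ∀ u ∈ U, ∀ x (ξ : Fin d → ℝ),
      (1 / C₀) * ∑ i, ξ i ^ 2 ≤ ∑ i, ∑ j, ξ i * S x u i j * ξ j)
    (hr : ∀ u ∈ U, ∀ x, |r x u| ≤ C₀) (hb : ∀ u ∈ U, ∀ x i, |b x u i| ≤ C₀)
    (hS : ∀ u ∈ U, ∀ x i j, |S x u i j| ≤ C₀)
    (hSα : ∀ u ∈ U, ∀ x y, dist x y ≤ 1 → ∀ i j, |S x u i j - S y u i j| ≤ C₀ * dist x y ^ α)
    (hS0 : ∀ u ∈ U, ∀ x i j, |S x u i j - S0 x i j| ≤ ε₀)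
    {vstar vprev vnext : 𝔼 → ℝ} (hvs : ContDiff ℝ 2 vstar) (hvp : ContDiff ℝ 2 vprev)
    (hvn : ContDiff ℝ 2 vnext)
    (hstar : ∀ x, ρ * vstar x =
      expF d l lam U r b S x (fun i => pd1 d vstar x i) (hessian d vstar x))
    (hnext : ∀ x, ρ * vnext x
          - (∫ u in U, r x u * gibbsPolicy d l lam U r b S vprev x u)
          - (∑ i, (∫ u in U, b x u i * gibbsPolicy d l lam U r b S vprev x u) * pd1 d vnext x i)
          - (1/2) * (∑ i, ∑ j,
              (∫ u in U, S x u i j * gibbsPolicy d l lam U r b S vprev x u) * pd2 d vnext x j i)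
          + lam * (∫ u in U, Real.log (gibbsPolicy d l lam U r b S vprev x u) *
              gibbsPolicy d l lam U r b S vprev x u) = 0)
    (hR : 2 * R ≤ 1) (hδ : 2 * ε₀ + C₀ * (2 * R) ^ α ≤ 2 * δ) (x₀ : 𝔼) :
    ∃ A : Fin d → Fin d → ℝ, (∀ i j, A i j = A j i) ∧ (∀ i j, |A i j| ≤ C₀) ∧
      (∀ ξ : Fin d → ℝ, 1 / C₀ * ∑ i, ξ i ^ 2 ≤ ∑ i, ∑ j, ξ i * A i j * ξ j) ∧
      ∀ x ∈ ball x₀ (2 * R), |ρ * (vnext x - vstar x) -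
          1 / 2 * ∑ i, ∑ j, A i j * pd2 d (fun y => vnext y - vstar y) x i j| ≤
        (2 * C₀ * (∑ i, |pd1 d (fun y => vprev y - vstar y) x i|) +
          ε₀ * ∑ i, ∑ j, |pd2 d (fun y => vprev y - vstar y) x i j|) +
        C₀ * (∑ i, |pd1 d (fun y => vnext y - vstar y) x i|) +
        δ * ∑ i, ∑ j, |pd2 d (fun y => vnext y - vstar y) x i j| := by
  have hprob : IsProbabilityMeasure (volume.restrict U) := ⟨by simp [hvol]⟩
  obtain ⟨u₀, hu₀⟩ : U.Nonempty := nonempty_of_measure_ne_zero (μ := volume) (by simp [hvol])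
  refine ⟨fun i j => (S x₀ u₀ i j + S x₀ u₀ j i) / 2, fun i j => by ring, fun i j => ?_,
    symmetrization_elliptic (hell u₀ hu₀ x₀), fun x hx => ?_⟩
  · have h1 := hS u₀ hu₀ x₀ i j
    have h2 := hS u₀ hu₀ x₀ j i
    rw [abs_le] at h1 h2 ⊢
    constructor <;> linarith
  have hi := integrable_exp_gibbsExponent hU hlam (hrm x) (hbm x) (hSm x) (fun u hu => hr u hu x)
    (fun u hu => hb u hu x) (fun u hu => hS u hu x) (fun i => pd1 d vprev x i) (hessian d vprev x)
  have hstep := abs_policy_step_le hU hlam (hrm x) (hbm x) (hSm x) (fun u hu => hr u hu x)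
    (fun u hu => hb u hu x) (fun u hu => hS u hu x) (fun u hu => hS0 u hu x)
    (fun i => pd1 d vprev x i) (fun i => pd1 d vstar x i) (fun i => pd1 d vnext x i)
    (hessian d vprev x) (hessian d vstar x) (hessian d vnext x)
    (g := gibbsPolicy d l lam U r b S vprev x) rfl (hstar x) (hnext x)
  have e1 : ∀ {v : 𝔼 → ℝ}, ContDiff ℝ 2 v → ∀ i, pd1 d v x i - pd1 d vstar x i =
      pd1 d (fun y => v y - vstar y) x i := fun hv i =>
    (pd1_sub (hv.differentiable (by norm_num) x) (hvs.differentiable (by norm_num) x) i).symm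
  have e2 : ∀ {v : 𝔼 → ℝ}, ContDiff ℝ 2 v → ∀ i j, hessian d v x i j - hessian d vstar x i j =
      pd2 d (fun y => v y - vstar y) x i j := fun hv i j => (pd2_sub hv hvs x i j).symm
  simp only [abs_sub_comm (pd1 d vstar x _), abs_sub_comm (hessian d vstar x _ _), e1 hvn, e1 hvp,
    e2 hvn, e2 hvp] at hstep
  rw [Finset.sum_comm (f := fun i j => |pd2 d (fun y => vprev y - vstar y) x j i|)] at hstep
  have hw : ContDiff ℝ 2 fun y => vnext y - vstar y := hvn.sub hvs
  refine (abs_freeze_le (M := S x₀ u₀) (D := 2 * δ)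
    (f := fun i => pd1 d (fun y => vnext y - vstar y) x i)
    (h := fun i j => pd2 d (fun y => vnext y - vstar y) x i j) (fun i => ?_) (fun i j => ?_)
    (fun i j => pd2_symm hw x i j) hstep).trans (le_of_eq (by ring))
  · simpa [gibbsPolicy] using abs_integral_mul_gibbsDensity_sub_le hU hi (hbm x i) (c := 0)
      fun u hu => by simpa using hb u hu x i
  · refine abs_integral_mul_gibbsDensity_sub_le hU hi (hSm x i j) fun u hu => ?_
    have hx' : dist x x₀ ≤ 2 * R := (mem_ball.1 hx).le
    have h1 := hSα u hu x x₀ (hx'.trans hR) i j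
    have h2 := hS0 u hu x₀ i j
    have h3 := hS0 u₀ hu₀ x₀ i j
    have h4 : C₀ * dist x x₀ ^ α ≤ C₀ * (2 * R) ^ α := by gcongr
    rw [abs_le] at h1 h2 h3 ⊢
    constructor <;> linarith

lemma continuous_source {w : 𝔼 → ℝ} (hw : ContDiff ℝ 2 w) (a b : ℝ) :
    Continuous fun x => 2 * a * (∑ i, |pd1 d w x i|) + b * ∑ i, ∑ j, |pd2 d w x i j| :=
  (continuous_const.mul (continuous_finsetSum _ fun i _ =>
    (pd1_continuous (hw.of_le (by norm_num)) i).abs)).add (continuous_const.mul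
    (continuous_finsetSum _ fun i _ => continuous_finsetSum _ fun j _ =>
      (pd2_continuous hw i j).abs))

/-- Under smallness of `ε₀` and largeness of `ρ`, the local energy of the error contracts. -/
lemma energy_contraction {R N θ L : ℝ} {w w' : 𝔼 → ℝ} (hw : ContDiff ℝ 2 w)
    (hρ : 0 < ρ) (hL : 0 ≤ L) (hNρ : N * (8 * C₀ ^ 2 * d) ≤ θ / 2 * ρ)
    (hNε : N * (2 * ε₀ ^ 2 * d ^ 2) ≤ θ / 2)
    (hg : ∀ x₀, ∫ x in ball x₀ R, gradSq w x ≤ L)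
    (hh : ∀ x₀, ∫ x in ball x₀ R, hessSq w x ≤ ρ * L)
    (hest : ∀ Γ, (∀ x₀, ∫ x in ball x₀ R,
        (2 * C₀ * (∑ i, |pd1 d w x i|) + ε₀ * ∑ i, ∑ j, |pd2 d w x i j|) ^ 2 ≤ Γ) →
      ∀ x₀, ρ ^ 2 * (∫ x in ball x₀ R, w' x ^ 2) + ρ * (∫ x in ball x₀ R, gradSq w' x) +
        (∫ x in ball x₀ R, hessSq w' x) ≤ N * Γ) (x₀ : 𝔼) :
    ρ * (∫ x in ball x₀ R, w' x ^ 2) ≤ θ * L ∧ ∫ x in ball x₀ R, gradSq w' x ≤ θ * L ∧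
      ∫ x in ball x₀ R, hessSq w' x ≤ ρ * (θ * L) := by
  have cG : Continuous fun x =>
      (2 * C₀ * (∑ i, |pd1 d w x i|) + ε₀ * ∑ i, ∑ j, |pd2 d w x i j|) ^ 2 :=
    (continuous_source hw C₀ ε₀).pow 2
  have h := hest (8 * C₀ ^ 2 * d * L + 2 * ε₀ ^ 2 * d ^ 2 * (ρ * L)) (fun y => by
    have h := setIntegral_le_combination₃ (s := ball y R) isBounded_ball measurableSet_ball cG
      (gradSq_continuous (hw.of_le (by norm_num))) (hessSq_continuous hw) continuous_zero
      (8 * C₀ ^ 2 * d) (2 * ε₀ ^ 2 * d ^ 2) 0 fun x _ => by simpa using sq_source_le w x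
    refine h.trans ?_
    have h1 := mul_le_mul_of_nonneg_left (hg y) (by positivity : 0 ≤ 8 * C₀ ^ 2 * d)
    have h2 := mul_le_mul_of_nonneg_left (hh y) (by positivity : 0 ≤ 2 * ε₀ ^ 2 * d ^ 2)
    linarith) x₀
  have h0 : N * (8 * C₀ ^ 2 * d * L + 2 * ε₀ ^ 2 * d ^ 2 * (ρ * L)) ≤ ρ * (θ * L) := by
    have h1 := mul_le_mul_of_nonneg_right hNρ hL
    have h2 := mul_le_mul_of_nonneg_right hNε (by positivity : 0 ≤ ρ * L)
    linarith
  have i0 : 0 ≤ ∫ x in ball x₀ R, w' x ^ 2 := integral_nonneg fun x => sq_nonneg _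
  have i1 : 0 ≤ ∫ x in ball x₀ R, gradSq w' x := integral_nonneg (gradSq_nonneg w')
  have i2 : 0 ≤ ∫ x in ball x₀ R, hessSq w' x := integral_nonneg (hessSq_nonneg w')
  have j0 := mul_nonneg (sq_nonneg ρ) i0
  have j1 := mul_nonneg hρ.le i1
  refine ⟨le_of_mul_le_mul_left ?_ hρ, le_of_mul_le_mul_left ?_ hρ, ?_⟩ <;> linarith

end ErrorContraction

section PolicyIteration

variable {d : ℕ}

local notation "𝔼" => EuclideanSpace ℝ (Fin d)

lemma exists_freezing_radius (d : ℕ) {α C₀ : ℝ} (hα : 0 < α) (hC₀ : 1 ≤ C₀) :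
    ∃ δ R : ℝ, 0 < δ ∧ 0 < R ∧ 2 * R ≤ 1 ∧ C₀ * (2 * R) ^ α ≤ δ ∧
      5 * δ ^ 2 * d ^ 2 ≤ (1 / C₀) ^ 2 / 64 := by
  have hC : 0 < C₀ := by linarith
  obtain ⟨δ, hδ⟩ : ∃ δ : ℝ, δ = 1 / (20 * (d + 1) * C₀) := ⟨_, rfl⟩
  have hδ0 : 0 < δ := hδ ▸ by positivity
  have hδ1 : δ ≤ 1 := by
    rw [hδ]
    refine div_le_one_of_le₀ ?_ (by positivity)
    nlinarith [(Nat.cast_nonneg d : (0 : ℝ) ≤ d)]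
  have hq : 0 < δ / C₀ := by positivity
  have e : 2 * ((δ / C₀) ^ (1 / α) / 2) = (δ / C₀) ^ (1 / α) := by ring
  refine ⟨δ, (δ / C₀) ^ (1 / α) / 2, hδ0, by positivity, ?_, ?_, ?_⟩
  · rw [e]
    exact rpow_le_one hq.le ((div_le_one hC).2 (hδ1.trans hC₀)) (by positivity)
  · rw [e, ← rpow_mul hq.le, one_div_mul_cancel hα.ne', rpow_one, mul_div_cancel₀ _ hC.ne']
  · have e1 : 5 * δ ^ 2 * d ^ 2 = (1 / C₀) ^ 2 / 80 * (d / (d + 1)) ^ 2 := by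
      rw [hδ]
      field_simp
      ring
    have h1 : (d / (d + 1) : ℝ) ^ 2 ≤ 1 :=
      pow_le_one₀ (by positivity) (div_le_one_of_le₀ (by linarith) (by positivity))
    have h2 : 0 < (1 / C₀) ^ 2 := by positivity
    rw [e1]
    nlinarith

lemma gradSq_le_of_abs_le {w : 𝔼 → ℝ} {x : 𝔼} {B : ℝ} (h : ∀ i, |pd1 d w x i| ≤ B) :
    gradSq w x ≤ d * B ^ 2 := by
  refine (Finset.sum_le_card_nsmul _ _ (B ^ 2) fun i _ => ?_).trans (by simp)
  exact sq_le_sq.2 ((h i).trans (le_abs_self B))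

lemma hessSq_le_of_abs_le {w : 𝔼 → ℝ} {x : 𝔼} {B : ℝ} (h : ∀ i j, |pd2 d w x i j| ≤ B) :
    hessSq w x ≤ d ^ 2 * B ^ 2 := by
  refine (Finset.sum_le_card_nsmul _ _ (d * B ^ 2) fun i _ => ?_).trans
    (le_of_eq (by simp; ring))
  refine (Finset.sum_le_card_nsmul _ _ (B ^ 2) fun j _ => ?_).trans (by simp)
  exact sq_le_sq.2 ((h i j).trans (le_abs_self B))

lemma abs_pd1_sub_le {f g : 𝔼 → ℝ} (hf : ContDiff ℝ 2 f) (hg : ContDiff ℝ 2 g) {x : 𝔼} {B : ℝ}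
    (h : ‖fderiv ℝ f x‖ + ‖fderiv ℝ g x‖ ≤ B) (i : Fin d) :
    |pd1 d (fun y => f y - g y) x i| ≤ B := by
  rw [pd1_sub (hf.differentiable (by norm_num) x) (hg.differentiable (by norm_num) x)]
  exact (abs_sub _ _).trans ((add_le_add (abs_pd1_le f x i) (abs_pd1_le g x i)).trans h)

lemma abs_pd2_sub_le {f g : 𝔼 → ℝ} (hf : ContDiff ℝ 2 f) (hg : ContDiff ℝ 2 g) {x : 𝔼} {B : ℝ}
    (h : ‖iteratedFDeriv ℝ 2 f x‖ + ‖iteratedFDeriv ℝ 2 g x‖ ≤ B) (i j : Fin d) :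
    |pd2 d (fun y => f y - g y) x i j| ≤ B := by
  rw [pd2_sub hf hg]
  exact (abs_sub _ _).trans ((add_le_add (abs_pd2_le hf x i j) (abs_pd2_le hg x i j)).trans h)

lemma volume_real_ball_le {R : ℝ} (hR : R ≤ 1) :
    volume.real (ball (0 : 𝔼) R) ≤ volume.real (ball (0 : 𝔼) 1) :=
  measureReal_mono (ball_subset_ball hR) measure_ball_lt_top.ne

end PolicyIteration

/-- Theorem 3.2: quantitative local `L²` convergence of policy iteration with bounded
coefficients under (cond1), (cond2), `|U| = 1`, Lipschitz `Σ₀` and (cond3).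
Here `C` depends only on `d` and the bound `B` on `‖v⁰‖₂ + ‖v*‖₂`, while `A₁` and `C'`
may depend also on `α`, `λ` and `C₀`. -/
theorem stmt7 (d l : ℕ) (B : ℝ) (hB : 1 ≤ B) :
    ∃ C : ℝ, 0 < C ∧
    ∀ (α lam C₀ : ℝ), 0 < α → α < 1 → 0 < lam → 1 ≤ C₀ →
    ∃ A₁ : ℝ, 1 ≤ A₁ ∧ ∃ C' : ℝ, 0 < C' ∧
    ∀ (U : Set (EuclideanSpace ℝ (Fin l)))
      (r : EuclideanSpace ℝ (Fin d) → EuclideanSpace ℝ (Fin l) → ℝ)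
      (b : EuclideanSpace ℝ (Fin d) → EuclideanSpace ℝ (Fin l) → Fin d → ℝ)
      (S : EuclideanSpace ℝ (Fin d) → EuclideanSpace ℝ (Fin l) → Matrix (Fin d) (Fin d) ℝ)
      (S0 : EuclideanSpace ℝ (Fin d) → Matrix (Fin d) (Fin d) ℝ)
      (ε₀ ε₁ ρ : ℝ)
      (vstar : EuclideanSpace ℝ (Fin d) → ℝ)
      (v : ℕ → EuclideanSpace ℝ (Fin d) → ℝ),
      MeasurableSet U → Bornology.IsBounded U → volume U = 1 →
      -- measurability in the control variable
      (∀ x, Measurable fun u => r x u) →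
      (∀ x i, Measurable fun u => b x u i) →
      (∀ x i j, Measurable fun u => S x u i j) →
      -- (cond1)
      (∀ u ∈ U, ∀ x (ξ : Fin d → ℝ),
        (1 / C₀) * ∑ i, ξ i ^ 2 ≤ ∑ i, ∑ j, ξ i * S x u i j * ξ j) →
      (∀ u ∈ U, ∀ x, |r x u| ≤ C₀) →
      (∀ u ∈ U, ∀ x y, dist x y ≤ 1 → |r x u - r y u| ≤ C₀ * dist x y ^ α) →
      (∀ u ∈ U, ∀ x i, |b x u i| ≤ C₀) →
      (∀ u ∈ U, ∀ x y, dist x y ≤ 1 → ∀ i, |b x u i - b y u i| ≤ C₀ * dist x y ^ α) →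
      (∀ u ∈ U, ∀ x i j, |S x u i j| ≤ C₀) →
      (∀ u ∈ U, ∀ x y, dist x y ≤ 1 → ∀ i j, |S x u i j - S y u i j| ≤ C₀ * dist x y ^ α) →
      -- (cond2)
      0 < ε₀ → ε₀ < 1 → 0 < ε₁ → ε₁ < 1 →
      (∀ u ∈ U, ∀ x i j, |S x u i j - S0 x i j| ≤ ε₀) →
      (∀ u ∈ U, ∀ x y, dist x y ≤ 1 → ∀ i j,
        |(S x u i j - S0 x i j) - (S y u i j - S0 y i j)| ≤ ε₁ * dist x y ^ α) →
      -- Σ₀ is Lipschitz continuous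
      (∃ K, ∀ x y i j, |S0 x i j - S0 y i j| ≤ K * dist x y) →
      -- v* is a bounded C^{2,α} classical solution of the exploratory HJB equation
      ContDiff ℝ 2 vstar →
      (∃ K, ∀ x y, dist x y ≤ 1 →
        ‖iteratedFDeriv ℝ 2 vstar x - iteratedFDeriv ℝ 2 vstar y‖ ≤ K * dist x y ^ α) →
      (∀ x, ρ * vstar x =
        expF d l lam U r b S x (fun i => pd1 d vstar x i) (hessian d vstar x)) →
      -- v⁰ ∈ C^{2,α}(ℝ^d)
      ContDiff ℝ 2 (v 0) →
      (∃ K, ∀ x y, dist x y ≤ 1 →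
        ‖iteratedFDeriv ℝ 2 (v 0) x - iteratedFDeriv ℝ 2 (v 0) y‖ ≤ K * dist x y ^ α) →
      -- ‖v⁰‖₂ + ‖v*‖₂ ≤ B
      (∀ x, (|v 0 x| + ‖fderiv ℝ (v 0) x‖ + ‖iteratedFDeriv ℝ 2 (v 0) x‖) +
        (|vstar x| + ‖fderiv ℝ vstar x‖ + ‖iteratedFDeriv ℝ 2 vstar x‖) ≤ B) →
      -- the iterates are bounded classical solutions of the linearized equations
      (∀ n : ℕ, 1 ≤ n → ContDiff ℝ 2 (v n) ∧ ∃ M, ∀ x, |v n x| ≤ M) →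
      (∀ n : ℕ, 1 ≤ n → ∀ x,
        ρ * v n x
          - (∫ u in U, r x u * gibbsPolicy d l lam U r b S (v (n - 1)) x u)
          - (∑ i, (∫ u in U, b x u i * gibbsPolicy d l lam U r b S (v (n - 1)) x u) *
              pd1 d (v n) x i)
          - (1/2) * (∑ i, ∑ j,
              (∫ u in U, S x u i j * gibbsPolicy d l lam U r b S (v (n - 1)) x u) *
                pd2 d (v n) x j i)
          + lam * (∫ u in U, Real.log (gibbsPolicy d l lam U r b S (v (n - 1)) x u) *
              gibbsPolicy d l lam U r b S (v (n - 1)) x u) = 0) →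
      -- (cond3)
      A₁ ^ (2 / (1 - α)) ≤ ρ → ε₀ * A₁ * ρ ^ (α/2) ≤ 1 → ε₁ * A₁ ≤ 1 →
      -- conclusion
      ∀ n : ℕ, 1 ≤ n → ∀ x₀ : EuclideanSpace ℝ (Fin d),
        ρ * (∫ x in Metric.ball x₀ 1, (v n x - vstar x) ^ 2) +
          (∫ x in Metric.ball x₀ 1, ‖fderiv ℝ (v n) x - fderiv ℝ vstar x‖ ^ 2) ≤
          C * (2 : ℝ) ^ (-(n : ℝ)) + C' * ε₀ ^ 2 / ρ := by
  obtain ⟨L₀, hL₀⟩ : ∃ L₀ : ℝ, L₀ = ((d : ℝ) + d ^ 2) * B ^ 2 *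
      volume.real (ball (0 : EuclideanSpace ℝ (Fin d)) 1) := ⟨_, rfl⟩
  have hL₀0 : 0 ≤ L₀ := hL₀ ▸ by positivity
  refine ⟨2 * L₀ + 1, by positivity, fun α lam C₀ hα hα1 hlam hC₀ => ?_⟩
  have hC₀0 : 0 < C₀ := by linarith
  obtain ⟨δ, R, hδ, hR, hR1, hRα, hδd⟩ := exists_freezing_radius d hα hC₀
  obtain ⟨N, hN, hest⟩ := uniform_local_estimate d (C := C₀) (one_div_pos.2 hC₀0) hR hδd
  obtain ⟨N₁, hN₁, hcov⟩ := exists_ball_covering_bound d hR 1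
  obtain ⟨A₁, hA₁⟩ : ∃ A₁ : ℝ, A₁ = N + 32 * N * N₁ * C₀ ^ 2 * d + 8 * N * N₁ * d ^ 2 + 2 / δ :=
    ⟨_, rfl⟩
  have hA₁N : N ≤ A₁ := by
    have : 0 ≤ 32 * N * N₁ * C₀ ^ 2 * d + 8 * N * N₁ * d ^ 2 + 2 / δ := by positivity
    linarith
  have hA₁ρ : 32 * N * N₁ * C₀ ^ 2 * d ≤ A₁ := by
    have : 0 ≤ N + 8 * N * N₁ * d ^ 2 + 2 / δ := by positivity
    linarith
  have hA₁ε : 8 * N * N₁ * d ^ 2 ≤ A₁ := by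
    have : 0 ≤ N + 32 * N * N₁ * C₀ ^ 2 * d + 2 / δ := by positivity
    linarith
  have hA₁δ : 2 / δ ≤ A₁ := by
    have : 0 ≤ N + 32 * N * N₁ * C₀ ^ 2 * d + 8 * N * N₁ * d ^ 2 := by positivity
    linarith
  have hA₁1 : 1 ≤ A₁ := hN.trans hA₁N
  refine ⟨A₁, hA₁1, 1, one_pos, ?_⟩
  intro U r b S S0 ε₀ ε₁ ρ vstar v hU _ hvol hrm hbm hSm hell hr _ hb _ hS hSα hε₀ hε₀1 _ _ hS0 _ _
    hvs _ hstar hv0 _ hB0 hvn hpde hρ hερ _ n hn x₀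
  have hρA : A₁ ≤ ρ := by
    refine (self_le_rpow_of_one_le hA₁1 ?_).trans hρ
    rw [le_div_iff₀ (by linarith)]
    linarith
  have hρ1 : 1 ≤ ρ := hA₁1.trans hρA
  have hρ0 : 0 < ρ := by linarith
  have hεA : ε₀ * A₁ ≤ 1 := by
    refine le_trans ?_ hερ
    exact le_mul_of_one_le_right (by positivity) (one_le_rpow hρ1 (by positivity))
  have hεδ : 2 * ε₀ ≤ δ := by
    have h := (mul_le_mul_of_nonneg_left hA₁δ hε₀.le).trans hεA
    rwa [mul_div_assoc', div_le_one hδ, mul_comm] at h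
  obtain ⟨θ, hθ⟩ : ∃ θ : ℝ, θ = 1 / (2 * N₁) := ⟨_, rfl⟩
  have hθ0 : 0 < θ := hθ ▸ by positivity
  have hθ2 : θ ≤ 1 / 2 := by
    rw [hθ]
    gcongr
    linarith
  have hNρ : N * (8 * C₀ ^ 2 * d) ≤ θ / 2 * ρ := by
    have e : θ / 2 * ρ = ρ / (4 * N₁) := by
      rw [hθ]
      field_simp
      norm_num
    rw [e, le_div_iff₀ (by positivity)]
    linarith
  have hNε : N * (2 * ε₀ ^ 2 * d ^ 2) ≤ θ / 2 := by
    have e : θ / 2 = 1 / (4 * N₁) := by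
      rw [hθ]
      field_simp
      norm_num
    have h1 := mul_le_mul_of_nonneg_left hA₁ε hε₀.le
    have h2 : ε₀ ^ 2 * (8 * N * N₁ * d ^ 2) ≤ ε₀ * (8 * N * N₁ * d ^ 2) := by
      gcongr
      nlinarith
    rw [e, le_div_iff₀ (by positivity)]
    linarith
  have hv2 : ∀ m, ContDiff ℝ 2 (v m) := fun m => by
    rcases Nat.eq_zero_or_pos m with rfl | hm
    · exact hv0
    · exact (hvn m hm).1
  have hw : ∀ m, ContDiff ℝ 2 fun x => v m x - vstar x := fun m => (hv2 m).sub hvs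
  have hfz := fun m x₀ => exists_frozen_coefficients hα hU hvol hlam hC₀0.le hrm hbm hSm hell hr
    hb hS hSα hS0 hvs (hv2 m) (hv2 (m + 1)) hstar (hpde (m + 1) (Nat.le_add_left 1 m)) hR1
    (δ := δ) (by linarith) x₀
  have hstep : ∀ (m : ℕ) (L : ℝ), 0 ≤ L →
      (∀ x₀, ∫ x in ball x₀ R, gradSq (fun y => v m y - vstar y) x ≤ L) →
      (∀ x₀, ∫ x in ball x₀ R, hessSq (fun y => v m y - vstar y) x ≤ ρ * L) →
      ∀ x₀, ρ * (∫ x in ball x₀ R, (v (m + 1) x - vstar x) ^ 2) ≤ θ * L ∧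
        ∫ x in ball x₀ R, gradSq (fun y => v (m + 1) y - vstar y) x ≤ θ * L ∧
        ∫ x in ball x₀ R, hessSq (fun y => v (m + 1) y - vstar y) x ≤ ρ * (θ * L) := by
    intro m L hL hg hh
    obtain ⟨M, hM⟩ := (hvn (m + 1) (Nat.le_add_left 1 m)).2
    have hMB : ∀ x, |v (m + 1) x - vstar x| ≤ M + B := fun x => by
      refine (abs_sub _ _).trans (add_le_add (hM x) ?_)
      linarith [hB0 x, abs_nonneg (v 0 x), norm_nonneg (fderiv ℝ (v 0) x),
        norm_nonneg (iteratedFDeriv ℝ 2 (v 0) x), norm_nonneg (fderiv ℝ vstar x),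
        norm_nonneg (iteratedFDeriv ℝ 2 vstar x)]
    exact energy_contraction (hw m) hρ0 hL hNρ hNε hg hh fun Γ hΓ =>
      hest ρ Γ (M + B) _ _ (hA₁N.trans hρA) (hw (m + 1)) hMB
        (continuous_source (hw m) C₀ ε₀) hΓ (hfz m)
  have hind : ∀ m : ℕ, (∀ x₀, ∫ x in ball x₀ R, gradSq (fun y => v m y - vstar y) x ≤ θ ^ m * L₀) ∧
      ∀ x₀, ∫ x in ball x₀ R, hessSq (fun y => v m y - vstar y) x ≤ ρ * (θ ^ m * L₀) := by
    intro m
    induction m with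
    | zero =>
      have hvol0 := volume_real_ball_le (d := d) (R := R) (by linarith)
      have hvol1 : 0 ≤ volume.real (ball (0 : EuclideanSpace ℝ (Fin d)) 1) := measureReal_nonneg
      have hd1 : 0 ≤ (d : ℝ) * B ^ 2 := by positivity
      have hd2 : 0 ≤ (d : ℝ) ^ 2 * B ^ 2 := by positivity
      have hB1 : ∀ x, ‖fderiv ℝ (v 0) x‖ + ‖fderiv ℝ vstar x‖ ≤ B := fun x => by
        linarith [hB0 x, abs_nonneg (v 0 x), norm_nonneg (iteratedFDeriv ℝ 2 (v 0) x),
          abs_nonneg (vstar x), norm_nonneg (iteratedFDeriv ℝ 2 vstar x)]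
      have hB2 : ∀ x, ‖iteratedFDeriv ℝ 2 (v 0) x‖ + ‖iteratedFDeriv ℝ 2 vstar x‖ ≤ B :=
        fun x => by
          linarith [hB0 x, abs_nonneg (v 0 x), norm_nonneg (fderiv ℝ (v 0) x),
            abs_nonneg (vstar x), norm_nonneg (fderiv ℝ vstar x)]
      have k1 := mul_le_mul_of_nonneg_left hvol0 hd1
      have k2 := mul_le_mul_of_nonneg_left hvol0 hd2
      have k3 := mul_nonneg hd1 hvol1
      have k4 := mul_nonneg hd2 hvol1
      rw [pow_zero, one_mul]
      refine ⟨fun y => ?_, fun y => ?_⟩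
      · refine (setIntegral_ball_le_of_le (gradSq_continuous ((hw 0).of_le (by norm_num)))
          (fun x => gradSq_le_of_abs_le (abs_pd1_sub_le hv0 hvs (hB1 x))) y R).trans ?_
        linarith
      · refine (setIntegral_ball_le_of_le (hessSq_continuous (hw 0))
          (fun x => hessSq_le_of_abs_le (abs_pd2_sub_le hv0 hvs (hB2 x))) y R).trans ?_
        refine le_trans ?_ (le_mul_of_one_le_left hL₀0 hρ1)
        linarith
    | succ m ih =>
      have h := hstep m _ (by positivity) ih.1 ih.2
      rw [pow_succ', mul_assoc]
      exact ⟨fun y => (h y).2.1, fun y => (h y).2.2⟩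
  obtain ⟨m, rfl⟩ : ∃ m, n = m + 1 := ⟨n - 1, by omega⟩
  have hm := hstep m _ (by positivity) (hind m).1 (hind m).2
  have hw1 : ContDiff ℝ 1 fun x => v (m + 1) x - vstar x := (hw (m + 1)).of_le (by norm_num)
  have h0 := hcov (fun x => (v (m + 1) x - vstar x) ^ 2) (θ * (θ ^ m * L₀) / ρ)
    (hw1.continuous.pow 2) (fun x => sq_nonneg _)
    (fun y => (le_div_iff₀' hρ0).2 (hm y).1) x₀
  have h1 := hcov _ (θ * (θ ^ m * L₀)) (gradSq_continuous hw1) (gradSq_nonneg _)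
    (fun y => (hm y).2.1) x₀
  have h2 : ∫ x in ball x₀ 1, ‖fderiv ℝ (v (m + 1)) x - fderiv ℝ vstar x‖ ^ 2 ≤
      ∫ x in ball x₀ 1, gradSq (fun y => v (m + 1) y - vstar y) x := by
    refine setIntegral_mono (integrableOn_of_isBounded isBounded_ball ?_)
      (integrableOn_of_isBounded isBounded_ball (gradSq_continuous hw1)) fun x => ?_
    · exact (((hv2 (m + 1)).continuous_fderiv (by norm_num)).sub
        (hvs.continuous_fderiv (by norm_num))).norm.pow 2
    · have h := norm_sq_fderiv_le (fun y => v (m + 1) y - vstar y) x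
      rwa [fderiv_fun_sub ((hv2 (m + 1)).differentiable (by norm_num) x)
        (hvs.differentiable (by norm_num) x)] at h
  have h3 : ρ * (∫ x in ball x₀ 1, (v (m + 1) x - vstar x) ^ 2) ≤ N₁ * (θ * (θ ^ m * L₀)) := by
    refine (mul_le_mul_of_nonneg_left h0 hρ0.le).trans (le_of_eq ?_)
    field_simp
  have h4 : N₁ * (θ * (θ ^ m * L₀)) = θ ^ m * L₀ / 2 := by
    have : N₁ * θ = 1 / 2 := by
      rw [hθ]
      field_simp
    linear_combination θ ^ m * L₀ * this
  have h5 : θ ^ m * L₀ ≤ (1 / 2) ^ m * L₀ := by gcongr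
  have h6 : (2 : ℝ) ^ (-((m + 1 : ℕ) : ℝ)) = (1 / 2) ^ m / 2 := by
    rw [rpow_neg (by norm_num), rpow_natCast, pow_succ, one_div, inv_pow, mul_inv,
      div_eq_mul_inv]
  have h7 : (0 : ℝ) < (1 / 2) ^ m := by positivity
  have h8 : 0 ≤ 1 * ε₀ ^ 2 / ρ := by positivity
  rw [h6]
  linarith
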